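/- arXiv:funct-an/9602008 — 3 statements merged into one kernel-verified Lean document; each statement's English description precedes it below -/
import Mathlib

section
/- Let α be an automorphism of a unital C*-algebra A satisfying the unital Rohlin property: for any k ∈ ℕ there are positive integers k₁,…,k_m ≥ k such that for any finite subset F of A and any ε > 0 there exist projections {e_{i,j} : i = 1,…,m, j = 0,…,k_i−1} in A with Σ_{i,j} e_{i,j} = 1, ‖α(e_{i,j}) − e_{i,j+1}‖ < ε, and ‖[x, e_{i,j}]‖ < ε for all i, j and x ∈ F (indices cyclic, e_{i,k_i} = e_{i,0}). Then α has the Rohlin property in the sense of Definition 2.1 (where in the unital case A + ℂ1 = A). -/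
/-!
Statement 3: for a unital C*-algebra `A`, the unital Rohlin property (with towers of
projections summing to `1`, almost cyclically permuted by `α` and almost commuting with a
given finite set) implies the Rohlin property of Definition 2.1, where in the unital case
the minimal unitization is `A + ℂ1 = A` itself (so the unitaries `U` of Definition 2.1
are the unitaries of `A`).
-/

variable {A : Type*} [CStarAlgebra A]

/-- A projection in a C*-algebra: a self-adjoint idempotent. -/
def IsProjection (e : A) : Prop := IsSelfAdjoint e ∧ e * e = e

/-- The unital Rohlin property for an automorphism `α` of a unital C*-algebra: for any
`k ∈ ℕ` there are positive integers `k₁, …, k_m ≥ k` such that for any finite `F ⊆ A` and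
`ε > 0` there are projections `e_{i,j}` (`i = 1, …, m`, `j = 0, …, k_i - 1`, cyclic in `j`)
with `∑ e_{i,j} = 1`, `‖α (e_{i,j}) - e_{i,j+1}‖ < ε` and `‖[x, e_{i,j}]‖ < ε` for
`x ∈ F`. -/
def UnitalRohlinProperty (α : A ≃⋆ₐ[ℂ] A) : Prop :=
  ∀ k : ℕ, ∃ (m : ℕ) (ks : Fin m → ℕ), 0 < m ∧ (∀ i, 0 < ks i ∧ k ≤ ks i) ∧
    ∀ (F : Finset A) (ε : ℝ), 0 < ε →
      ∃ P : Fin m → ℕ → A,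
        (∀ i, ∀ j < ks i, IsProjection (P i j)) ∧
        (∑ i, ∑ j ∈ Finset.range (ks i), P i j) = 1 ∧
        (∀ i, ∀ j < ks i, ‖α (P i j) - P i ((j + 1) % ks i)‖ < ε) ∧
        (∀ i, ∀ j < ks i, ∀ x ∈ F, ‖x * P i j - P i j * x‖ < ε)

/-- Definition 2.1 for a unital C*-algebra `A`, where `A + ℂ1 = A` and `Ad U ∘ α` sends
`x` to `U * α x * U*` for a unitary `U` of `A`. -/
def RohlinProperty (α : A ≃⋆ₐ[ℂ] A) : Prop :=
  ∀ k : ℕ, ∃ (m : ℕ) (ks : Fin m → ℕ), 0 < m ∧ (∀ i, 0 < ks i ∧ k ≤ ks i) ∧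
    ∀ (E e : A) (U : A) (F : Finset A) (ε : ℝ),
      IsProjection E → IsProjection e → U ∈ unitary A →
      (∀ x ∈ F, E * x * E = x) → 0 < ε →
      e * E = e →
      (U * α e * star U) * E = U * α e * star U →
      e ∈ F → U * α e * star U ∈ F →
      ∃ P : Fin m → ℕ → A,
        (∀ i, ∀ j < ks i, IsProjection (P i j)) ∧
        (∑ i, ∑ j ∈ Finset.range (ks i), P i j) = E ∧
        (∀ i, ∀ j < ks i,
          ‖U * α (P i j * e) * star U - P i ((j + 1) % ks i) * (U * α e * star U)‖ < ε) ∧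
        (∀ i, ∀ j < ks i, ∀ x ∈ F, ‖x * P i j - P i j * x‖ < ε)

theorem IsProjection.norm_le {e : A} (h : IsProjection e) : ‖e‖ ≤ 1 := by
  have h1 : ‖e‖ = ‖e‖ * ‖e‖ := by
    have := CStarRing.norm_star_mul_self (x := e)
    rwa [h.1.star_eq, h.2] at this
  nlinarith [norm_nonneg e, sq_nonneg (‖e‖ - 1)]

theorem norm_le_one_of_isometry {U : A} (h : star U * U = 1) : ‖U‖ ≤ 1 := by
  have h1 := CStarRing.norm_star_mul_self (x := U)
  have h2 : ‖(1 : A)‖ ≤ 1 := IsProjection.norm_le ⟨IsSelfAdjoint.one A, one_mul 1⟩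
  rw [h] at h1
  nlinarith [norm_nonneg U]

/-- Spectral projection of an almost idempotent self-adjoint element. -/
theorem exists_spectral_projection {D : A} (hD : IsSelfAdjoint D)
    (h : ‖D * D - D‖ ≤ 3 / 16) :
    ∃ p : A, IsProjection p ∧ ‖p - D‖ ≤ 2 * ‖D * D - D‖ ∧
      ∀ x, Commute D x → Commute p x := by
  let f : ℝ → ℝ := fun t => max 0 (min 1 (4 * (t - 1 / 2) + 1 / 2))
  have hf : Continuous f := by fun_prop
  have hcfc : cfc (fun t : ℝ => t * t - t) D = D * D - D := by
    rw [cfc_sub (fun t : ℝ => t * t) (fun t => t) D, cfc_mul (fun t : ℝ => t) (fun t => t) D,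
      cfc_id' ℝ D]
  have hs : ∀ t ∈ spectrum ℝ D, |t * t - t| ≤ ‖D * D - D‖ := by
    intro t ht
    have := norm_apply_le_norm_cfc (fun t : ℝ => t * t - t) D ht
    rwa [hcfc] at this
  have hcase : ∀ t ∈ spectrum ℝ D, (t ≤ 1 / 4 ∧ f t = 0) ∨ (3 / 4 ≤ t ∧ f t = 1) := by
    intro t ht
    have h1 := (abs_le.1 ((hs t ht).trans h)).1
    have h2 : t ≤ 1 / 4 ∨ 3 / 4 ≤ t := by
      by_contra hc
      push Not at hc
      nlinarith [mul_pos (sub_pos.2 hc.1) (sub_pos.2 hc.2)]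
    rcases h2 with h2 | h2
    · left
      refine ⟨h2, ?_⟩
      apply max_eq_left
      exact (min_le_right _ _).trans (by linarith)
    · right
      refine ⟨h2, ?_⟩
      change max 0 (min 1 (4 * (t - 1 / 2) + 1 / 2)) = 1
      rw [min_eq_left (by linarith)]
      norm_num
  refine ⟨cfc f D, ⟨cfc_predicate f D, ?_⟩, ?_, fun x hx => hx.cfc_real f⟩
  · rw [← cfc_mul f f D hf.continuousOn hf.continuousOn]
    apply cfc_congr
    intro t ht
    rcases hcase t ht with ⟨_, h0⟩ | ⟨_, h0⟩ <;> simp [h0]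
  · have : cfc (fun t => f t - t) D = cfc f D - D := by
      rw [cfc_sub f (fun t => t) D hf.continuousOn, cfc_id' ℝ D]
    rw [← this]
    apply norm_cfc_le (by positivity)
    intro t ht
    have h3 := hs t ht
    rw [Real.norm_eq_abs]
    have h4 : |t * t - t| = |t| * |t - 1| := by rw [← abs_mul]; ring_nf
    rw [h4] at h3
    rcases hcase t ht with ⟨h1, h0⟩ | ⟨h1, h0⟩
    · rw [h0, zero_sub, abs_neg]
      have : 1 / 2 ≤ |t - 1| := by rw [abs_sub_comm]; exact le_trans (by linarith) (le_abs_self _)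
      nlinarith [abs_nonneg t]
    · rw [h0, abs_sub_comm]
      have : 1 / 2 ≤ |t| := le_trans (by linarith) (le_abs_self _)
      nlinarith [abs_nonneg (t - 1)]

/-- Inverse square root of a self-adjoint element near `1`. -/
theorem exists_inv_sqrt {B : A} (hB : IsSelfAdjoint B) (h : ‖B - 1‖ ≤ 1 / 2) :
    ∃ R : A, IsSelfAdjoint R ∧ R * B * R = 1 ∧ ‖R - 1‖ ≤ 2 * ‖B - 1‖ ∧
      ∀ x, Commute B x → Commute R x := by
  let f : ℝ → ℝ := fun t => (√(max t (1 / 2)))⁻¹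
  have hf : Continuous f := by
    apply Continuous.inv₀ (by fun_prop)
    intro t
    have : 0 < max t (1 / 2) := lt_max_of_lt_right (by norm_num)
    positivity
  have hcfc : cfc (fun t : ℝ => t - 1) B = B - 1 := by
    rw [cfc_sub (fun t : ℝ => t) (fun t => 1) B, cfc_const_one ℝ B, cfc_id' ℝ B]
  have hs : ∀ t ∈ spectrum ℝ B, |t - 1| ≤ ‖B - 1‖ := by
    intro t ht
    have := norm_apply_le_norm_cfc (fun t : ℝ => t - 1) B ht
    rwa [hcfc] at this
  have hcase : ∀ t ∈ spectrum ℝ B, 1 / 2 ≤ t ∧ f t = (√t)⁻¹ := by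
    intro t ht
    have h1 := (abs_le.1 ((hs t ht).trans h)).1
    have h2 : 1 / 2 ≤ t := by linarith
    refine ⟨h2, ?_⟩
    change (√(max t (1 / 2)))⁻¹ = _
    rw [max_eq_left h2]
  refine ⟨cfc f B, cfc_predicate f B, ?_, ?_, fun x hx => hx.cfc_real f⟩
  · have : cfc (fun t => f t * t * f t) B = cfc f B * B * cfc f B := by
      rw [cfc_mul (fun t => f t * t) f B (by fun_prop) hf.continuousOn,
        cfc_mul f (fun t => t) B hf.continuousOn, cfc_id' ℝ B]
    rw [← this, ← cfc_const_one ℝ B]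
    apply cfc_congr
    intro t ht
    obtain ⟨h1, h2⟩ := hcase t ht
    have h3 : √t * √t = t := Real.mul_self_sqrt (by linarith)
    have h4 : 0 < √t := Real.sqrt_pos.2 (by linarith)
    simp only [h2]
    field_simp
    nlinarith
  · have : cfc (fun t => f t - 1) B = cfc f B - 1 := by
      rw [cfc_sub f (fun t => 1) B hf.continuousOn, cfc_const_one ℝ B]
    rw [← this]
    apply norm_cfc_le (by positivity)
    intro t ht
    refine le_trans ?_ (mul_le_mul_of_nonneg_left (hs t ht) zero_le_two)
    obtain ⟨h1, h2⟩ := hcase t ht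
    have h3 : √t * √t = t := Real.mul_self_sqrt (by linarith)
    have h4 : 0 < √t := Real.sqrt_pos.2 (by linarith)
    rw [h2, Real.norm_eq_abs]
    have h5 : t - 1 = -(((√t)⁻¹ - 1) * (√t + t)) := by
      field_simp
      nlinarith
    rw [h5, abs_neg, abs_mul, abs_of_pos (a := √t + t) (by linarith)]
    nlinarith [abs_nonneg ((√t)⁻¹ - 1)]

/-- Nearby projections are unitarily equivalent by a unitary near `1`. -/
theorem exists_unitary_conj {E p : A} (hE : IsProjection E) (hp : IsProjection p)
    (h : ‖p - E‖ ≤ 1 / 16) :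
    ∃ W : A, star W * W = 1 ∧ W * star W = 1 ∧ W * p = E * W ∧ ‖W - 1‖ ≤ 14 * ‖p - E‖ := by
  obtain ⟨hEs, hEi⟩ := hE
  obtain ⟨hps, hpi⟩ := hp
  have hEn := IsProjection.norm_le ⟨hEs, hEi⟩
  have hpn := IsProjection.norm_le ⟨hps, hpi⟩
  set d := ‖p - E‖ with hd
  have hd0 : 0 ≤ d := norm_nonneg _
  obtain ⟨Z, hZ⟩ : ∃ Z, Z = E * p + (1 - E) * (1 - p) := ⟨_, rfl⟩
  have hZs : star Z = p * E + (1 - p) * (1 - E) := by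
    rw [hZ]; simp [hEs.star_eq, hps.star_eq]
  have hZ1 : Z - 1 = E * (p - E) - (p - E) * p := by
    rw [hZ]; simp only [mul_sub, sub_mul, hEi, hpi, mul_one, one_mul]; abel
  have hy : ‖Z - 1‖ ≤ 2 * d := by
    rw [hZ1]
    have h1 : ‖E * (p - E)‖ ≤ 1 * d := norm_mul_le_of_le hEn le_rfl
    have h2 : ‖(p - E) * p‖ ≤ d * 1 := norm_mul_le_of_le le_rfl hpn
    linarith [norm_sub_le (E * (p - E)) ((p - E) * p)]
  have hys : ‖star Z - 1‖ ≤ 2 * d := by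
    rwa [← norm_star, star_sub, star_star, star_one]
  have hB1 : star Z * Z - 1 = (star Z - 1) * (Z - 1) + ((star Z - 1) + (Z - 1)) := by
    noncomm_ring
  have hB : ‖star Z * Z - 1‖ ≤ 5 * d := by
    rw [hB1]
    have h1 : ‖(star Z - 1) * (Z - 1)‖ ≤ (2 * d) * (2 * d) := norm_mul_le_of_le hys hy
    have h2 := norm_add_le (star Z - 1) (Z - 1)
    have h3 := norm_add_le ((star Z - 1) * (Z - 1)) ((star Z - 1) + (Z - 1))
    nlinarith
  obtain ⟨R, hRs, hR1, hRn, hRc⟩ :=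
    exists_inv_sqrt (IsSelfAdjoint.star_mul_self Z) (by linarith)
  have hZp : Z * p = E * Z := by
    rw [hZ]
    simp only [mul_sub, sub_mul, mul_add, add_mul, mul_one, one_mul, mul_assoc, hpi]
    simp only [← mul_assoc, hEi]
    abel
  have hZsE : star Z * E = p * star Z := by
    have := congrArg star hZp
    simpa [hEs.star_eq, hps.star_eq] using this.symm
  have hRp : R * p = p * R := by
    apply hRc
    change star Z * Z * p = p * (star Z * Z)
    rw [mul_assoc, hZp, ← mul_assoc, hZsE, mul_assoc]
  have hW1 : star (Z * R) * (Z * R) = 1 := by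
    rw [star_mul, hRs.star_eq, ← hR1]; simp only [mul_assoc]
  have hWn : ‖Z * R - 1‖ ≤ 14 * d := by
    have h0 : Z * R - 1 = (Z - 1) * (R - 1) + ((Z - 1) + (R - 1)) := by noncomm_ring
    rw [h0]
    have h1 : ‖(Z - 1) * (R - 1)‖ ≤ (2 * d) * (2 * (5 * d)) :=
      norm_mul_le_of_le hy (hRn.trans (by linarith))
    have h2 := norm_add_le (Z - 1) (R - 1)
    have h3 := norm_add_le ((Z - 1) * (R - 1)) ((Z - 1) + (R - 1))
    nlinarith
  have hu : IsUnit (Z * R) := by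
    have := isUnit_one_sub_of_norm_lt_one (x := 1 - Z * R) (by
      rw [norm_sub_rev]; linarith)
    simpa using this
  refine ⟨Z * R, hW1, ?_, ?_, hWn⟩
  · obtain ⟨u, hu⟩ := hu
    rw [← hu] at hW1 ⊢
    rw [Units.eq_inv_of_mul_eq_one_right hW1]
    simp
  · rw [mul_assoc, hRp, ← mul_assoc, hZp, mul_assoc]

/-- Projections that sum to `1` are mutually orthogonal. -/
theorem orthogonal_of_sum_eq_one {ι : Type*} [DecidableEq ι] {s : Finset ι} {Q : ι → A}
    (hQ : ∀ n ∈ s, IsProjection (Q n)) (hsum : ∑ n ∈ s, Q n = 1) {a b : ι}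
    (ha : a ∈ s) (hb : b ∈ s) (hab : a ≠ b) : Q a * Q b = 0 := by
  letI := CStarAlgebra.spectralOrder A
  haveI := CStarAlgebra.spectralOrderedRing A
  have hform : ∀ n ∈ s, Q b * Q n * Q b = star (Q n * Q b) * (Q n * Q b) := by
    intro n hn
    rw [star_mul, (hQ n hn).1.star_eq, (hQ b hb).1.star_eq]
    rw [mul_assoc, mul_assoc, ← mul_assoc (Q n) (Q n), (hQ n hn).2]
  have h1 : ∑ n ∈ s, Q b * Q n * Q b = Q b := by
    rw [← Finset.sum_mul, ← Finset.mul_sum, hsum, mul_one, (hQ b hb).2]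
  have h2 : ∑ n ∈ s.erase b, Q b * Q n * Q b = 0 := by
    rw [← Finset.add_sum_erase _ _ hb, (hQ b hb).2, (hQ b hb).2] at h1
    simpa using h1
  have h3 := (Finset.sum_eq_zero_iff_of_nonneg (fun n hn => by
    rw [hform n (Finset.mem_of_mem_erase hn)]; exact star_mul_self_nonneg _)).1 h2 a
      (Finset.mem_erase.2 ⟨hab, ha⟩)
  rw [hform a ha] at h3
  exact CStarRing.star_mul_self_eq_zero_iff _ |>.1 h3

/-- Main perturbation lemma. -/
theorem exists_corner_partition {ι : Type*} [DecidableEq ι] {s : Finset ι} {Q : ι → A}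
    (hQ : ∀ n ∈ s, IsProjection (Q n)) (hsum : ∑ n ∈ s, Q n = 1) {E : A}
    (hE : IsProjection E) {δ : ℝ} (hδ0 : 0 ≤ δ) (hδ : (s.card : ℝ) * δ ≤ 1 / 200)
    (hc : ∀ n ∈ s, ‖E * Q n - Q n * E‖ ≤ δ) :
    ∃ P : ι → A, (∀ n ∈ s, IsProjection (P n)) ∧ ∑ n ∈ s, P n = E ∧
      ∀ n ∈ s, ‖P n - Q n * E‖ ≤ 300 * (s.card * δ) := by
  set η : ℝ := s.card * δ with hη
  have hη0 : 0 ≤ η := by positivity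
  obtain ⟨D, hD⟩ : ∃ D, D = ∑ n ∈ s, Q n * E * Q n := ⟨_, rfl⟩
  have hDs : IsSelfAdjoint D := by
    rw [hD, IsSelfAdjoint, star_sum]
    refine Finset.sum_congr rfl fun n hn => ?_
    simp only [star_mul, (hQ n hn).1.star_eq, hE.1.star_eq, mul_assoc]
  have hDQ : ∀ a ∈ s, Commute D (Q a) := by
    intro a ha
    have h1 : D * Q a = Q a * E * Q a := by
      rw [hD, Finset.sum_mul, Finset.sum_eq_single_of_mem a ha]
      · rw [mul_assoc, (hQ a ha).2]
      · intro b hb hba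
        rw [mul_assoc, orthogonal_of_sum_eq_one hQ hsum hb ha hba, mul_zero]
    have h2 : Q a * D = Q a * E * Q a := by
      rw [hD, Finset.mul_sum, Finset.sum_eq_single_of_mem a ha]
      · rw [← mul_assoc, ← mul_assoc, (hQ a ha).2]
      · intro b hb hba
        rw [← mul_assoc, ← mul_assoc, orthogonal_of_sum_eq_one hQ hsum ha hb hba.symm,
          zero_mul, zero_mul]
    exact h1.trans h2.symm
  have hDE : ‖D - E‖ ≤ η := by
    have h1 : D - E = ∑ n ∈ s, Q n * (E * Q n - Q n * E) := by
      have : E = ∑ n ∈ s, Q n * E := by rw [← Finset.sum_mul, hsum, one_mul]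
      rw [hD]
      nth_rewrite 2 [this]
      rw [← Finset.sum_sub_distrib]
      refine Finset.sum_congr rfl fun n hn => ?_
      rw [mul_sub, ← mul_assoc, ← mul_assoc, (hQ n hn).2]
    rw [h1, hη, ← nsmul_eq_mul]
    refine (norm_sum_le _ _).trans (Finset.sum_le_card_nsmul _ _ _ fun n hn => ?_)
    simpa using norm_mul_le_of_le (hQ n hn).norm_le (hc n hn)
  have hEn := hE.norm_le
  have hDD : ‖D * D - D‖ ≤ 4 * η := by
    have h0 : D * D - D = (D - E) * (D - E) + (E * (D - E) + ((D - E) * E - (D - E))) := by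
      simp only [mul_sub, sub_mul, hE.2]; abel
    rw [h0]
    have h1 : ‖(D - E) * (D - E)‖ ≤ η * η := norm_mul_le_of_le hDE hDE
    have h2 : ‖E * (D - E)‖ ≤ 1 * η := norm_mul_le_of_le hEn hDE
    have h3 : ‖(D - E) * E‖ ≤ η * 1 := norm_mul_le_of_le hDE hEn
    have h4 := norm_add_le_of_le h1 (norm_add_le_of_le h2 (norm_sub_le_of_le h3 hDE))
    nlinarith
  obtain ⟨p, hp, hpD, hpc⟩ := exists_spectral_projection hDs (by linarith)
  have hpE : ‖p - E‖ ≤ 9 * η := by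
    have := norm_add_le (p - D) (D - E)
    rw [sub_add_sub_cancel] at this
    linarith
  obtain ⟨W, hW1, hW2, hWp, hWn⟩ := exists_unitary_conj hE hp (by linarith)
  have hpQ : ∀ n ∈ s, p * Q n = Q n * p := fun n hn => hpc _ (hDQ n hn)
  refine ⟨fun n => W * (Q n * p) * star W, ?_, ?_, ?_⟩
  · intro n hn
    refine ⟨?_, ?_⟩
    · simp only [IsSelfAdjoint, star_mul, star_star, (hQ n hn).1.star_eq, hp.1.star_eq, hpQ n hn,
        mul_assoc]
    · have h1 : (Q n * p) * (Q n * p) = Q n * p := by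
        rw [mul_assoc, ← mul_assoc p, hpQ n hn, mul_assoc, hp.2, ← mul_assoc, (hQ n hn).2]
      calc W * (Q n * p) * star W * (W * (Q n * p) * star W)
          = W * (Q n * p) * (star W * W) * (Q n * p) * star W := by simp only [mul_assoc]
        _ = W * ((Q n * p) * (Q n * p)) * star W := by rw [hW1]; simp only [mul_assoc, one_mul]
        _ = _ := by rw [h1]
  · rw [← Finset.sum_mul, ← Finset.mul_sum, ← Finset.sum_mul, hsum, one_mul, hWp, mul_assoc,
      hW2, mul_one]
  · intro n hn
    have hx : ‖Q n * p‖ ≤ 1 * 1 := norm_mul_le_of_le (hQ n hn).norm_le hp.norm_le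
    have hWs : ‖star W‖ ≤ 1 := by rw [norm_star]; exact norm_le_one_of_isometry hW1
    have hWn' : ‖W - 1‖ ≤ 126 * η := by linarith
    have hWsn : ‖star W - 1‖ ≤ 126 * η := by
      rwa [← norm_star, star_sub, star_star, star_one]
    have h0 : W * (Q n * p) * star W - Q n * E
        = (W - 1) * (Q n * p) * star W + ((Q n * p) * (star W - 1) + Q n * (p - E)) := by
      noncomm_ring
    change ‖W * (Q n * p) * star W - Q n * E‖ ≤ _
    rw [h0]
    have h1 := norm_add_le_of_le (norm_mul_le_of_le (norm_mul_le_of_le hWn' hx) hWs)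
      (norm_add_le_of_le (norm_mul_le_of_le hx hWsn) (norm_mul_le_of_le (hQ n hn).norm_le hpE))
    linarith

/-- The unital Rohlin property implies the Rohlin property of Definition 2.1. -/
theorem rohlinProperty_of_unitalRohlinProperty
    (α : A ≃⋆ₐ[ℂ] A) (hα : UnitalRohlinProperty α) :
    RohlinProperty α := by
  classical
  intro k
  obtain ⟨m, ks, hm, hks, H⟩ := hα k
  refine ⟨m, ks, hm, hks, ?_⟩
  intro E e U F ε hE he hU hF hε heE hfE heF hfF
  let s : Finset ((_ : Fin m) × ℕ) := Finset.univ.sigma fun i => Finset.range (ks i)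
  have hmem : ∀ i, ∀ j < ks i, (⟨i, j⟩ : (_ : Fin m) × ℕ) ∈ s := by
    intro i j hj
    simp [s, hj]
  obtain ⟨N, hN⟩ : ∃ N : ℝ, N = s.card := ⟨_, rfl⟩
  have hN0 : 0 ≤ N := by rw [hN]; positivity
  obtain ⟨M, hM⟩ : ∃ M : ℝ, M = 1 + ∑ x ∈ F, ‖x‖ := ⟨_, rfl⟩
  have hM1 : 1 ≤ M := by
    rw [hM]; linarith [Finset.sum_nonneg fun x (_ : x ∈ F) => norm_nonneg x]
  have hMF : ∀ x ∈ F, ‖x‖ ≤ M := by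
    intro x hx
    rw [hM]; linarith [Finset.single_le_sum (fun x (_ : x ∈ F) => norm_nonneg x) hx]
  have hNM : 0 ≤ N * M := by positivity
  have hNM' : N ≤ N * M := by nlinarith
  obtain ⟨δ, hδ0, hδ1, hδ2⟩ : ∃ δ : ℝ, 0 < δ ∧ N * δ ≤ 1 / 200 ∧
      (600 * (N * M) + 2) * δ < ε := by
    refine ⟨min (1 / (200 * (N + 1))) (ε / (600 * (N * M) + 3)), by positivity, ?_, ?_⟩
    · calc N * min (1 / (200 * (N + 1))) (ε / (600 * (N * M) + 3))
          ≤ (N + 1) * (1 / (200 * (N + 1))) :=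
            mul_le_mul (by linarith) (min_le_left _ _) (by positivity) (by positivity)
        _ = 1 / 200 := by field_simp
    · calc (600 * (N * M) + 2) * min (1 / (200 * (N + 1))) (ε / (600 * (N * M) + 3))
          ≤ (600 * (N * M) + 2) * (ε / (600 * (N * M) + 3)) :=
            mul_le_mul_of_nonneg_left (min_le_right _ _) (by positivity)
        _ < (600 * (N * M) + 3) * (ε / (600 * (N * M) + 3)) :=
            mul_lt_mul_of_pos_right (by linarith) (by positivity)
        _ = ε := by field_simp
  obtain ⟨Q, hQ, hQsum, hQα, hQF⟩ := H (insert E (insert U F)) δ hδ0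
  obtain ⟨P, hP, hPsum, hPn⟩ := exists_corner_partition (s := s) (Q := fun n => Q n.1 n.2)
    (by
      rintro ⟨i, j⟩ hn
      exact hQ i j (by simpa [s] using hn))
    (by rw [Finset.sum_sigma]; exact hQsum) hE hδ0.le (by rw [← hN]; exact hδ1)
    (by
      rintro ⟨i, j⟩ hn
      exact (hQF i j (by simpa [s] using hn) E (by simp)).le)
  rw [← hN] at hPn
  have hPn' : ∀ i, ∀ j < ks i, ‖P ⟨i, j⟩ - Q i j * E‖ ≤ 300 * (N * δ) :=
    fun i j hj => hPn _ (hmem i j hj)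
  refine ⟨fun i j => P ⟨i, j⟩, fun i j hj => hP _ (hmem i j hj), ?_, ?_, ?_⟩
  · rw [← hPsum, Finset.sum_sigma]
  · intro i j hj
    have hj' : (j + 1) % ks i < ks i := Nat.mod_lt _ (hks i).1
    have hα' := hQα i j hj
    change ‖U * α (P ⟨i, j⟩ * e) * star U
      - P ⟨i, (j + 1) % ks i⟩ * (U * α e * star U)‖ < ε
    generalize (j + 1) % ks i = l at hj' hα' ⊢
    have hEe : E * e = e := by
      have := congrArg star heE
      simpa [hE.1.star_eq, he.1.star_eq] using this
    have hαe : star (α e) = α e := by rw [← map_star, he.1.star_eq]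
    have hEf : E * (U * α e * star U) = U * α e * star U := by
      have := congrArg star hfE
      simpa [hE.1.star_eq, hαe, mul_assoc] using this
    have hUn : ‖U‖ ≤ 1 := norm_le_one_of_isometry (Unitary.mem_iff.1 hU).1
    have hUsn : ‖star U‖ ≤ 1 := by rwa [norm_star]
    have hαen : ‖α e‖ ≤ 1 := IsProjection.norm_le ⟨hαe, by rw [← map_mul, he.2]⟩
    have hfn : ‖U * α e * star U‖ ≤ 1 * 1 * 1 :=
      norm_mul_le_of_le (norm_mul_le_of_le hUn hαen) hUsn
    have hc : ‖α (P ⟨i, j⟩ - Q i j * E)‖ ≤ 300 * (N * δ) := by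
      rw [NonUnitalStarAlgHom.norm_map α (EquivLike.injective α)]; exact hPn' i j hj
    have h00 : α (P ⟨i, j⟩ * e) = α (P ⟨i, j⟩ - Q i j * E) * α e + α (Q i j) * α e := by
      rw [← map_mul, ← map_mul, ← map_add, sub_mul, mul_assoc, hEe, sub_add_cancel]
    have h01 : P ⟨i, l⟩ * (U * α e * star U)
        = (P ⟨i, l⟩ - Q i l * E) * (U * α e * star U) + Q i l * (U * α e * star U) := by
      rw [sub_mul, mul_assoc (Q i l), hEf, sub_add_cancel]
    have h0 : U * α (P ⟨i, j⟩ * e) * star U - P ⟨i, l⟩ * (U * α e * star U)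
        = U * (α (P ⟨i, j⟩ - Q i j * E) * α e) * star U
          + (U * ((α (Q i j) - Q i l) * α e) * star U
          + ((U * Q i l - Q i l * U) * (α e * star U)
            - (P ⟨i, l⟩ - Q i l * E) * (U * α e * star U))) := by
      rw [h00, h01]
      generalize α (P ⟨i, j⟩ - Q i j * E) = a
      generalize P ⟨i, l⟩ - Q i l * E = b
      noncomm_ring
    rw [h0]
    have h1 := norm_add_le_of_le
      (norm_mul_le_of_le (norm_mul_le_of_le hUn (norm_mul_le_of_le hc hαen)) hUsn)
      (norm_add_le_of_le
        (norm_mul_le_of_le (norm_mul_le_of_le hUn (norm_mul_le_of_le hα'.le hαen)) hUsn)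
        (norm_sub_le_of_le
          (norm_mul_le_of_le (hQF i l hj' U (by simp)).le (norm_mul_le_of_le hαen hUsn))
          (norm_mul_le_of_le (hPn' i l hj') hfn)))
    nlinarith
  · intro i j hj x hx
    have hxE : x * E = x := by
      rw [← hF x hx, mul_assoc, hE.2]
    have hEx : E * x = x := by
      rw [← hF x hx, ← mul_assoc, ← mul_assoc, hE.2]
    have h0 : x * P ⟨i, j⟩ - P ⟨i, j⟩ * x = x * (P ⟨i, j⟩ - Q i j * E)
        + ((x * Q i j - Q i j * x) * E - (P ⟨i, j⟩ - Q i j * E) * x) := by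
      simp only [mul_sub, sub_mul, mul_assoc, hxE, hEx]; abel
    change ‖x * P ⟨i, j⟩ - P ⟨i, j⟩ * x‖ < ε
    rw [h0]
    have h1 := norm_add_le_of_le (norm_mul_le_of_le (hMF x hx) (hPn' i j hj))
      (norm_sub_le_of_le (norm_mul_le_of_le
        (hQF i j hj x (by simp [hx])).le hE.norm_le)
        (norm_mul_le_of_le (hPn' i j hj) (hMF x hx)))
    nlinarith
end

section
/- Let A be a C*-algebra given with an increasing sequence (A_n) of finite-dimensional *-subalgebras whose union is dense in A, let α be an automorphism of A, and let ε > 0. Then there exist a strictly increasing sequence (n_k) of positive integers and a unitary U in A + ℂ1 such that ‖U − 1‖ < ε and, for every k, (Ad U∘α)(A_{n_k}) ⊆ A_{n_{k+1}} and (Ad U∘α)⁻¹(A_{n_k}) ⊆ A_{n_{k+1}}. -/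
/-!
Statement 4 (Remark 2.3): for an AF algebra `A = closure (⋃ Aₙ)` and an automorphism `α`
of `A`, for every `ε > 0` there are a strictly increasing sequence `(n_k)` of positive
integers and a unitary `U ∈ A + ℂ1` with `‖U - 1‖ < ε` such that
`(Ad U ∘ α)(A_{n_k}) ⊆ A_{n_{k+1}}` and `(Ad U ∘ α)⁻¹(A_{n_k}) ⊆ A_{n_{k+1}}` for all `k`.

The minimal unitization `A + ℂ1` is modelled by `Unitization ℂ A`, in which
`Ad U ∘ α (x) = U α(x) U*`; the two inclusions are expressed in the unitization.
-/

variable {A : Type*} [NonUnitalCStarAlgebra A]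

/-- The canonical extension of an automorphism of `A` to the minimal unitization
`A + ℂ1 = Unitization ℂ A`. -/
noncomputable def unitizationExt (α : A ≃⋆ₐ[ℂ] A) :
    Unitization ℂ A → Unitization ℂ A :=
  fun x => algebraMap ℂ (Unitization ℂ A) x.fst + ↑(α x.snd)

section AfpHelpers

theorem afp_sqrt_near {R : Type*} [CStarAlgebra R] (h : R) (hs : IsSelfAdjoint h)
    (hn : ‖h - 1‖ ≤ 1 / 2) :
    ∃ k l : R, IsSelfAdjoint k ∧ IsSelfAdjoint l ∧ k * k = h ∧ k * l = 1 ∧ l * k = 1 ∧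
      ‖k - 1‖ ≤ ‖h - 1‖ ∧ ‖l - 1‖ ≤ 2 * ‖h - 1‖ ∧ ∀ x, Commute h x → Commute l x := by
  have hsub : ∀ f : ℝ → ℝ, ContinuousOn f (spectrum ℝ h) →
      cfc (fun t => f t - 1) h = cfc f h - 1 := by
    intro f hf
    rw [cfc_sub _ _ h hf (by fun_prop), cfc_const_one ℝ h]
  have hid : cfc (fun t : ℝ => t - 1) h = h - 1 := by
    have := hsub (fun t => t) (by fun_prop)
    rw [this, cfc_id' ℝ h]
  have hsp : ∀ t ∈ spectrum ℝ h, |t - 1| ≤ ‖h - 1‖ := by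
    intro t ht
    have := norm_apply_le_norm_cfc (fun t : ℝ => t - 1) h ht
    rwa [hid, Real.norm_eq_abs] at this
  have hlow : ∀ t ∈ spectrum ℝ h, 1 / 4 ≤ t := by
    intro t ht
    have := (abs_le.1 ((hsp t ht).trans hn)).1
    linarith
  have hc1 : ContinuousOn (fun t : ℝ => √t) (spectrum ℝ h) := by fun_prop
  have hhalf : ∀ t ∈ spectrum ℝ h, 1 / 2 ≤ √t := by
    intro t ht
    apply Real.le_sqrt_of_sq_le
    have := hlow t ht
    linarith
  have hc2 : ContinuousOn (fun t : ℝ => (√t)⁻¹) (spectrum ℝ h) := by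
    apply ContinuousOn.inv₀ hc1
    intro t ht
    have := hhalf t ht
    intro h0
    rw [h0] at this
    norm_num at this
  have hb1 : ∀ t ∈ spectrum ℝ h, |√t - 1| ≤ |t - 1| := by
    intro t ht
    have h1 := hhalf t ht
    have h2 : t - 1 = (√t - 1) * (√t + 1) := by
      have := Real.mul_self_sqrt (by linarith [hlow t ht] : 0 ≤ t)
      linarith
    rw [h2, abs_mul]
    have : 1 ≤ |√t + 1| := by
      rw [abs_of_nonneg (by linarith)]; linarith
    nlinarith [abs_nonneg (√t - 1)]
  have hkl : cfc (fun t : ℝ => √t) h * cfc (fun t : ℝ => (√t)⁻¹) h = 1 := by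
    rw [← cfc_mul _ _ h hc1 hc2, ← cfc_const_one ℝ h]
    apply cfc_congr
    intro t ht
    have := hhalf t ht
    exact mul_inv_cancel₀ (by linarith)
  refine ⟨cfc (fun t : ℝ => √t) h, cfc (fun t : ℝ => (√t)⁻¹) h, cfc_predicate _ h,
    cfc_predicate _ h, ?_, hkl, ?_, ?_, ?_, ?_⟩
  · rw [← cfc_mul _ _ h hc1 hc1]
    conv_rhs => rw [← cfc_id' ℝ h]
    apply cfc_congr
    intro t ht
    exact Real.mul_self_sqrt (by linarith [hlow t ht])
  · rw [← hkl]; exact cfc_commute_cfc _ _ h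
  · rw [← hsub _ hc1]
    refine norm_cfc_le (norm_nonneg _) fun t ht => ?_
    exact (hb1 t ht).trans (hsp t ht)
  · rw [← hsub _ hc2]
    refine norm_cfc_le (by positivity) fun t ht => ?_
    have h1 := hhalf t ht
    have h2 := (hb1 t ht).trans (hsp t ht)
    have h3 : (√t)⁻¹ - 1 = -((√t)⁻¹ * (√t - 1)) := by
      rw [mul_sub, inv_mul_cancel₀ (by linarith)]; ring
    rw [h3, norm_neg, norm_mul, Real.norm_eq_abs, Real.norm_eq_abs]
    have h4 : |(√t)⁻¹| ≤ 2 := by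
      rw [abs_of_nonneg (by positivity)]
      rw [inv_le_comm₀ (by linarith) (by norm_num)]
      linarith
    exact mul_le_mul h4 h2 (abs_nonneg _) (by norm_num)
  · intro x hx
    exact hx.cfc_real _

theorem afp_isUnit_near {R : Type*} [NormedRing R] [CompleteSpace R] (v : R) (h : ‖v - 1‖ < 1) :
    IsUnit v := by
  have := isUnit_one_sub_of_norm_lt_one (x := 1 - v) (by rwa [norm_sub_rev])
  simpa using this

theorem afp_polar {R : Type*} [CStarAlgebra R] [Nontrivial R] (v : R) (hv : ‖v - 1‖ ≤ 1 / 6) :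
    ∃ u ∈ unitary R, ‖u - 1‖ ≤ 8 * ‖v - 1‖ ∧
      ∀ x y, v * x = y * v → v * star x = star y * v → u * x = y * u := by
  have hsv : ‖star v - 1‖ = ‖v - 1‖ := by
    rw [← norm_star (v - 1)]; simp
  have hv1 : ‖v‖ ≤ 1 + ‖v - 1‖ := by
    calc ‖v‖ = ‖1 + (v - 1)‖ := by simp
      _ ≤ _ := by
        refine (norm_add_le _ _).trans ?_
        simp
  have hh : ‖star v * v - 1‖ ≤ 3 * ‖v - 1‖ := by
    calc ‖star v * v - 1‖ = ‖(star v - 1) * v + (v - 1)‖ := by congr 1; noncomm_ring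
      _ ≤ ‖star v - 1‖ * ‖v‖ + ‖v - 1‖ := (norm_add_le _ _).trans (by gcongr; exact norm_mul_le _ _)
      _ ≤ _ := by rw [hsv]; nlinarith [norm_nonneg (v - 1)]
  obtain ⟨k, l, hk, hl, hkk, hkl, hlk, hk1, hl1, hcomm⟩ :=
    afp_sqrt_near (star v * v) (IsSelfAdjoint.star_mul_self v) (by linarith)
  have hvu : IsUnit v := afp_isUnit_near v (by linarith)
  have hlu : IsUnit l := ⟨⟨l, k, hlk, hkl⟩, rfl⟩
  have huu : star (v * l) * (v * l) = 1 := by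
    rw [star_mul, hl.star_eq]
    calc l * star v * (v * l) = l * (star v * v) * l := by noncomm_ring
      _ = (l * k) * (k * l) := by rw [← hkk]; noncomm_ring
      _ = 1 := by rw [hlk, hkl, one_mul]
  have hul : ‖l‖ ≤ 2 := by
    calc ‖l‖ = ‖1 + (l - 1)‖ := by simp
      _ ≤ _ := by
        refine (norm_add_le _ _).trans ?_
        rw [norm_one]; linarith
  refine ⟨v * l, ?_, ?_, ?_⟩
  · rw [Unitary.mem_iff]
    refine ⟨huu, ?_⟩
    obtain ⟨w, hw⟩ := hvu.mul hlu
    rw [← hw] at huu ⊢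
    have : star (w : R) = (↑w⁻¹ : R) := by
      rw [← mul_one (star (w : R)), ← w.mul_inv, ← mul_assoc, huu, one_mul]
    rw [this, w.mul_inv]
  · calc ‖v * l - 1‖ = ‖(v - 1) * l + (l - 1)‖ := by congr 1; noncomm_ring
      _ ≤ ‖v - 1‖ * ‖l‖ + ‖l - 1‖ := (norm_add_le _ _).trans (by gcongr; exact norm_mul_le _ _)
      _ ≤ _ := by nlinarith [norm_nonneg (v - 1)]
  · intro x y hxy hxy'
    have hc : Commute (star v * v) x := by
      have h1 : star v * y = x * star v := by
        have := congrArg star hxy'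
        simpa using this.symm
      change star v * v * x = x * (star v * v)
      rw [mul_assoc, hxy, ← mul_assoc, h1, mul_assoc]
    have := hcomm x hc
    rw [mul_assoc, this.eq, ← mul_assoc, hxy, mul_assoc]
open scoped TensorProduct

/-- A diagonal (separability idempotent), given by finite families. -/
structure AfpDiag (B : Type*) [Ring B] [Algebra ℂ B] where
  n : ℕ
  a : Fin n → B
  b : Fin n → B
  sum_mul : ∑ i, a i * b i = 1
  comm : ∀ x : B, ∑ i, (x * a i) ⊗ₜ[ℂ] b i = ∑ i, a i ⊗ₜ[ℂ] (b i * x)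

theorem AfpDiag.bilin {B : Type*} [Ring B] [Algebra ℂ B] (d : AfpDiag B) {M : Type*}
    [AddCommGroup M] [Module ℂ M] (f : B →ₗ[ℂ] B →ₗ[ℂ] M) (x : B) :
    ∑ i, f (x * d.a i) (d.b i) = ∑ i, f (d.a i) (d.b i * x) := by
  have := congrArg (TensorProduct.lift f) (d.comm x)
  simpa [map_sum] using this

theorem afp_exists_diag_of_fintype {B : Type*} [Ring B] [Algebra ℂ B] {ι : Type*} [Fintype ι]
    (a b : ι → B) (h1 : ∑ i, a i * b i = 1)
    (h2 : ∀ x : B, ∑ i, (x * a i) ⊗ₜ[ℂ] b i = ∑ i, a i ⊗ₜ[ℂ] (b i * x)) :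
    Nonempty (AfpDiag B) := by
  let e := (Fintype.equivFin ι).symm
  refine ⟨⟨Fintype.card ι, a ∘ e, b ∘ e, ?_, ?_⟩⟩
  · rw [← h1]; exact e.sum_comp (fun i => a i * b i)
  · intro x
    have := h2 x
    rw [← e.sum_comp, ← e.sum_comp (fun i => a i ⊗ₜ[ℂ] (b i * x))] at this
    exact this

theorem afp_diag_transport {B C : Type*} [Ring B] [Algebra ℂ B] [Ring C] [Algebra ℂ C]
    (e : B ≃ₐ[ℂ] C) (d : AfpDiag B) : Nonempty (AfpDiag C) := by
  refine ⟨⟨d.n, fun i => e (d.a i), fun i => e (d.b i), ?_, ?_⟩⟩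
  · simp_rw [← map_mul, ← map_sum, d.sum_mul, map_one]
  · intro x
    have := congrArg (TensorProduct.map e.toLinearMap e.toLinearMap) (d.comm (e.symm x))
    simpa [map_sum] using this

theorem afp_diag_matrix (n : ℕ) (d : Fin n → ℕ) (hd : ∀ i, NeZero (d i)) :
    Nonempty (AfpDiag (Π i, Matrix (Fin (d i)) (Fin (d i)) ℂ)) := by
  classical
  refine afp_exists_diag_of_fintype (ι := Σ i, Fin (d i))
    (fun p => Pi.single p.1 (Matrix.single p.2 0 1))
    (fun p => Pi.single p.1 (Matrix.single 0 p.2 1)) ?_ ?_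
  · rw [Fintype.sum_sigma]
    simp only [← Pi.single_mul, Matrix.single_mul_single_same, mul_one]
    have : ∀ i, ∑ j, (Pi.single i (Matrix.single j j 1) :
        Π i, Matrix (Fin (d i)) (Fin (d i)) ℂ) = Pi.single i 1 := by
      intro i
      rw [← Matrix.sum_single_one]
      exact (map_sum (AddMonoidHom.single (fun i => Matrix (Fin (d i)) (Fin (d i)) ℂ) i) _ _).symm
    simp only [this]
    exact Finset.univ_sum_single (1 : Π i, Matrix (Fin (d i)) (Fin (d i)) ℂ)
  · intro x
    rw [Fintype.sum_sigma, Fintype.sum_sigma]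
    refine Finset.sum_congr rfl fun i _ => ?_
    have hL : ∀ j, x * Pi.single i (Matrix.single j 0 1) =
        ∑ k, x i k j • (Pi.single i (Matrix.single k 0 1) :
          Π i, Matrix (Fin (d i)) (Fin (d i)) ℂ) := by
      intro j
      have h1 : x * Pi.single i (Matrix.single j 0 1) =
        Pi.single i (x i * Matrix.single j 0 1) := by
        ext i' : 1
        by_cases h : i' = i
        · subst h; simp
        · simp [h]
      rw [h1]
      have h2 : x i * Matrix.single j 0 1 = ∑ k, x i k j • Matrix.single k 0 (1 : ℂ) := by
        ext p q
        simp [Matrix.sum_apply, Matrix.mul_apply, Matrix.single_apply]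
        by_cases h : 0 = q <;> simp [h]
      rw [h2]
      have h3 := map_sum (LinearMap.single ℂ (fun i => Matrix (Fin (d i)) (Fin (d i)) ℂ) i)
        (fun k => x i k j • Matrix.single k 0 (1 : ℂ)) Finset.univ
      simp only [map_smul, LinearMap.single_apply] at h3
      exact h3
    have hR : ∀ j, Pi.single i (Matrix.single 0 j 1) * x =
        ∑ k, x i j k • (Pi.single i (Matrix.single 0 k 1) :
          Π i, Matrix (Fin (d i)) (Fin (d i)) ℂ) := by
      intro j
      have h1 : Pi.single i (Matrix.single 0 j 1) * x =
        Pi.single i (Matrix.single 0 j 1 * x i) := by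
        ext i' : 1
        by_cases h : i' = i
        · subst h; simp
        · simp [h]
      rw [h1]
      have h2 : Matrix.single 0 j 1 * x i = ∑ k, x i j k • Matrix.single 0 k (1 : ℂ) := by
        ext p q
        simp [Matrix.sum_apply, Matrix.mul_apply, Matrix.single_apply]
        by_cases h : 0 = p <;> simp [h]
      rw [h2]
      have h3 := map_sum (LinearMap.single ℂ (fun i => Matrix (Fin (d i)) (Fin (d i)) ℂ) i)
        (fun k => x i j k • Matrix.single 0 k (1 : ℂ)) Finset.univ
      simp only [map_smul, LinearMap.single_apply] at h3
      exact h3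
    simp only [hL, hR, TensorProduct.sum_tmul, TensorProduct.tmul_sum, TensorProduct.smul_tmul',
      TensorProduct.tmul_smul]
    rw [Finset.sum_comm]

theorem afp_exists_diag {R : Type*} [CStarAlgebra R] (B : StarSubalgebra ℂ R)
    [FiniteDimensional ℂ B] : Nonempty (AfpDiag B) := by
  have hart : IsArtinianRing B := IsArtinianRing.of_finite ℂ B
  have hss : IsSemisimpleRing B := by
    rw [IsArtinianRing.isSemisimpleRing_iff_jacobson, eq_bot_iff]
    intro x hx
    have hx' : star x * x ∈ Ring.jacobson B := Ideal.mul_mem_left _ _ hx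
    obtain ⟨n, hn⟩ := IsArtinianRing.isNilpotent_jacobson_bot (R := B)
    have hp : (star x * x) ^ n = 0 := by
      have := Ideal.pow_mem_pow (I := Ideal.jacobson (⊥ : Ideal B)) (x := star x * x)
        (by rwa [Ideal.jacobson_bot]) n
      rw [hn] at this
      simpa using this
    have hp2 : (star (x : R) * x) ^ (2 ^ n) = 0 := by
      have h1 : (star (x : R) * x) ^ n = 0 := by
        have := congrArg (Subtype.val) hp
        simpa using this
      exact pow_eq_zero_of_le (Nat.lt_two_pow_self).le h1
    have := (IsSelfAdjoint.star_mul_self (x : R)).nnnorm_pow_two_pow n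
    rw [hp2, nnnorm_zero] at this
    have h0 : ‖star (x : R) * x‖₊ = 0 := pow_eq_zero_iff (by positivity) |>.1 this.symm
    rw [nnnorm_eq_zero, CStarRing.star_mul_self_eq_zero_iff] at h0
    simpa using h0
  obtain ⟨n, d, hd, ⟨e⟩⟩ := IsSemisimpleRing.exists_algEquiv_pi_matrix_of_isAlgClosed ℂ B
  obtain ⟨D⟩ := afp_diag_matrix n d hd
  exact afp_diag_transport e.symm D
theorem afp_newton_step {B C : Type*} [NormedRing B] [NormedAlgebra ℂ B] [NormedRing C]
    [NormedAlgebra ℂ C] (d : AfpDiag B) (κ : ℝ) (hκ1 : 1 ≤ κ) (hκ : ∑ i, ‖d.a i‖ * ‖d.b i‖ ≤ κ)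
    (T : B →ₗ[ℂ] C) (s : ℝ) (hs : 0 ≤ s) (h1 : T 1 = 1) (hT : ∀ x, ‖T x‖ ≤ 2 * ‖x‖)
    (hψ : ∀ x y, ‖T (x * y) - T x * T y‖ ≤ s * ‖x‖ * ‖y‖) :
    ∃ T' : B →ₗ[ℂ] C, T' 1 = 1 ∧ (∀ x, ‖T' x - T x‖ ≤ 2 * κ * s * ‖x‖) ∧
      ∀ x y, ‖T' (x * y) - T' x * T' y‖ ≤ 6 * κ ^ 2 * s ^ 2 * ‖x‖ * ‖y‖ := by
  let X : B →ₗ[ℂ] C :=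
    { toFun := fun x => ∑ i, (T (x * d.a i) - T x * T (d.a i)) * T (d.b i)
      map_add' := by
        intro x y
        rw [← Finset.sum_add_distrib]
        refine Finset.sum_congr rfl fun i _ => ?_
        simp only [add_mul, map_add]
        noncomm_ring
      map_smul' := by
        intro c x
        simp only [smul_mul_assoc, map_smul, RingHom.id_apply, Finset.smul_sum, sub_mul, smul_sub] }
  have hX : ∀ x, X x = ∑ i, (T (x * d.a i) - T x * T (d.a i)) * T (d.b i) := fun _ => rfl
  have hXn : ∀ x, ‖X x‖ ≤ 2 * κ * s * ‖x‖ := by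
    intro x
    rw [hX]
    calc _ ≤ ∑ i, (s * ‖x‖ * ‖d.a i‖) * (2 * ‖d.b i‖) := by
          refine norm_sum_le_of_le _ fun i _ => (norm_mul_le _ _).trans ?_
          exact mul_le_mul (hψ _ _) (hT _) (norm_nonneg _) (by positivity)
      _ = (∑ i, ‖d.a i‖ * ‖d.b i‖) * (2 * s * ‖x‖) := by
          rw [Finset.sum_mul]; refine Finset.sum_congr rfl fun i _ => by ring
      _ ≤ κ * (2 * s * ‖x‖) := by gcongr
      _ = _ := by ring
  -- the key identity
  have key : ∀ x y, (T + X) (x * y) - (T + X) x * (T + X) y =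
      (T (x * y) - T x * T y) * (∑ i, (T (d.a i * d.b i) - T (d.a i) * T (d.b i)))
      + (∑ i, (T (x * d.a i) - T x * T (d.a i)) * (T (d.b i * y) - T (d.b i) * T y))
      - X x * X y := by
    intro x y
    have e1 : X (x * y) - T x * X y = ∑ i, ((T (x * (y * d.a i)) - T x * T (y * d.a i)) * T (d.b i))
        - (T (x * y) - T x * T y) * ∑ i, T (d.a i) * T (d.b i) := by
      rw [hX, hX, Finset.mul_sum, Finset.mul_sum, ← Finset.sum_sub_distrib,
        ← Finset.sum_sub_distrib]
      refine Finset.sum_congr rfl fun i _ => ?_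
      rw [mul_assoc x y]
      noncomm_ring
    let f : B →ₗ[ℂ] B →ₗ[ℂ] C := LinearMap.mk₂ ℂ (fun a b => (T (x * a) - T x * T a) * T b)
      (by intros; simp only [mul_add, map_add]; noncomm_ring)
      (by intros; simp only [mul_smul_comm, map_smul, ← smul_sub, smul_mul_assoc])
      (by intros; simp only [mul_add, map_add])
      (by intros; simp only [mul_smul_comm, map_smul])
    have e2 : ∑ i, ((T (x * (y * d.a i)) - T x * T (y * d.a i)) * T (d.b i)) =
        ∑ i, ((T (x * d.a i) - T x * T (d.a i)) * T (d.b i * y)) := d.bilin f y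
    have e3 : ∑ i, ((T (x * d.a i) - T x * T (d.a i)) * T (d.b i * y)) =
        X x * T y + ∑ i, (T (x * d.a i) - T x * T (d.a i)) * (T (d.b i * y) - T (d.b i) * T y) := by
      rw [hX, Finset.sum_mul, ← Finset.sum_add_distrib]
      refine Finset.sum_congr rfl fun i _ => ?_
      noncomm_ring
    have e4 : ∑ i, T (d.a i) * T (d.b i) =
        1 - ∑ i, (T (d.a i * d.b i) - T (d.a i) * T (d.b i)) := by
      rw [Finset.sum_sub_distrib, ← map_sum, d.sum_mul, h1]
      noncomm_ring
    rw [e2, e3, e4] at e1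
    have e5 : X (x * y) = T x * X y + (X (x * y) - T x * X y) := by noncomm_ring
    simp only [LinearMap.add_apply]
    rw [e5, e1]
    noncomm_ring
  refine ⟨T + X, ?_, ?_, ?_⟩
  · rw [LinearMap.add_apply, hX, h1]
    simp
  · intro x
    simpa using hXn x
  · intro x y
    rw [key]
    have b1 : ‖∑ i, (T (d.a i * d.b i) - T (d.a i) * T (d.b i))‖ ≤ κ * s := by
      calc _ ≤ ∑ i, s * ‖d.a i‖ * ‖d.b i‖ := norm_sum_le_of_le _ fun i _ => hψ _ _
        _ = (∑ i, ‖d.a i‖ * ‖d.b i‖) * s := by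
          rw [Finset.sum_mul]; refine Finset.sum_congr rfl fun i _ => by ring
        _ ≤ _ := by gcongr
    have b2 : ‖∑ i, (T (x * d.a i) - T x * T (d.a i)) * (T (d.b i * y) - T (d.b i) * T y)‖ ≤
        κ * (s ^ 2 * ‖x‖ * ‖y‖) := by
      calc _ ≤ ∑ i, (s * ‖x‖ * ‖d.a i‖) * (s * ‖d.b i‖ * ‖y‖) := by
            refine norm_sum_le_of_le _ fun i _ => (norm_mul_le _ _).trans ?_
            exact mul_le_mul (hψ _ _) (hψ _ _) (norm_nonneg _) (by positivity)
        _ = (∑ i, ‖d.a i‖ * ‖d.b i‖) * (s ^ 2 * ‖x‖ * ‖y‖) := by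
          rw [Finset.sum_mul]; refine Finset.sum_congr rfl fun i _ => by ring
        _ ≤ _ := by gcongr
    have b3 : ‖X x * X y‖ ≤ (2 * κ * s * ‖x‖) * (2 * κ * s * ‖y‖) :=
      (norm_mul_le _ _).trans (mul_le_mul (hXn _) (hXn _) (norm_nonneg _) (by positivity))
    have b4 : ‖(T (x * y) - T x * T y) * (∑ i, (T (d.a i * d.b i) - T (d.a i) * T (d.b i)))‖ ≤
        (s * ‖x‖ * ‖y‖) * (κ * s) :=
      (norm_mul_le _ _).trans (mul_le_mul (hψ _ _) b1 (norm_nonneg _) (by positivity))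
    refine (norm_sub_le _ _).trans ?_
    have := norm_add_le ((T (x * y) - T x * T y) *
      (∑ i, (T (d.a i * d.b i) - T (d.a i) * T (d.b i))))
      (∑ i, (T (x * d.a i) - T x * T (d.a i)) * (T (d.b i * y) - T (d.b i) * T y))
    have hk : κ * (s ^ 2 * ‖x‖ * ‖y‖) ≤ κ ^ 2 * (s ^ 2 * ‖x‖ * ‖y‖) := by
      apply mul_le_mul_of_nonneg_right _ (by positivity)
      nlinarith
    nlinarith

theorem afp_newton {B C : Type*} [NormedRing B] [NormedAlgebra ℂ B] [NormedRing C]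
    [NormedAlgebra ℂ C] [CompleteSpace C] (d : AfpDiag B) (κ : ℝ) (hκ1 : 1 ≤ κ)
    (hκ : ∑ i, ‖d.a i‖ * ‖d.b i‖ ≤ κ)
    (T : B →ₗ[ℂ] C) (s : ℝ) (hs : 0 ≤ s) (hsκ : 12 * κ ^ 2 * s ≤ 1) (h1 : T 1 = 1)
    (hT : ∀ x, ‖T x‖ ≤ 3 / 2 * ‖x‖)
    (hψ : ∀ x y, ‖T (x * y) - T x * T y‖ ≤ s * ‖x‖ * ‖y‖) :
    ∃ φ : B →ₐ[ℂ] C, ∀ x, ‖φ x - T x‖ ≤ 4 * κ * s * ‖x‖ := by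
  let P : ℕ → (B →ₗ[ℂ] C) → Prop := fun n S => S 1 = 1 ∧
    (∀ x, ‖S x - T x‖ ≤ 4 * κ * s * (1 - (1 / 2) ^ n) * ‖x‖) ∧
    ∀ x y, ‖S (x * y) - S x * S y‖ ≤ (s * (1 / 2) ^ n) * ‖x‖ * ‖y‖
  have hκs : 4 * κ * s ≤ 1 / 3 := by nlinarith
  have step : ∀ n S, P n S → ∃ S', P (n + 1) S' ∧
      ∀ x, ‖S' x - S x‖ ≤ 2 * κ * (s * (1 / 2) ^ n) * ‖x‖ := by
    rintro n S ⟨p1, p2, p3⟩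
    have hp : (0 : ℝ) < (1 / 2) ^ n := by positivity
    have hp1 : ((1 : ℝ) / 2) ^ n ≤ 1 := pow_le_one₀ (by norm_num) (by norm_num)
    have hS : ∀ x, ‖S x‖ ≤ 2 * ‖x‖ := by
      intro x
      have a1 : ‖S x‖ ≤ ‖S x - T x‖ + ‖T x‖ := by
        simpa using norm_add_le (S x - T x) (T x)
      have a2 := p2 x
      have a3 := hT x
      have a4 : 4 * κ * s * (1 - (1 / 2) ^ n) * ‖x‖ ≤ 1 / 2 * ‖x‖ := by
        gcongr
        have : 0 ≤ κ * s := by positivity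
        nlinarith
      linarith
    obtain ⟨S', q1, q2, q3⟩ := afp_newton_step d κ hκ1 hκ S (s * (1 / 2) ^ n) (by positivity) p1 hS p3
    refine ⟨S', ⟨q1, ?_, ?_⟩, q2⟩
    · intro x
      have a1 : ‖S' x - T x‖ ≤ ‖S' x - S x‖ + ‖S x - T x‖ := by
        simpa using norm_add_le (S' x - S x) (S x - T x)
      have a2 := p2 x
      have a3 := q2 x
      refine a1.trans ((add_le_add a3 a2).trans (le_of_eq ?_))
      ring
    · intro x y
      refine (q3 x y).trans ?_
      refine mul_le_mul_of_nonneg_right (mul_le_mul_of_nonneg_right ?_ (norm_nonneg _))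
        (norm_nonneg _)
      have : 6 * κ ^ 2 * (s * (1 / 2) ^ n) ^ 2 =
        (12 * κ ^ 2 * s) * (1 / 2) ^ n * (s * (1 / 2) ^ (n + 1)) := by ring
      rw [this]
      have h3 : (12 * κ ^ 2 * s) * (1 / 2) ^ n ≤ 1 := by
        have : 0 ≤ 12 * κ ^ 2 * s := by positivity
        nlinarith
      exact mul_le_of_le_one_left (by positivity) h3
  choose! F hF1 hF2 using step
  let S : ℕ → (B →ₗ[ℂ] C) := fun n => Nat.rec T (fun n S => F n S) n
  have hS0 : S 0 = T := rfl
  have hSs : ∀ n, S (n + 1) = F n (S n) := fun _ => rfl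
  have hP : ∀ n, P n (S n) := by
    intro n
    induction n with
    | zero => exact ⟨h1, by intro x; simp [hS0], by simpa [hS0] using hψ⟩
    | succ n ih => rw [hSs]; exact hF1 _ _ ih
  have hd : ∀ x n, dist (S n x) (S (n + 1) x) ≤ (4 * κ * s * ‖x‖) / 2 / 2 ^ n := by
    intro x n
    rw [dist_comm, dist_eq_norm, hSs]
    refine (hF2 n _ (hP n) x).trans (le_of_eq ?_)
    rw [one_div, inv_pow]
    field_simp
    ring
  have hcau : ∀ x, ∃ y, Filter.Tendsto (fun n => S n x) Filter.atTop (nhds y) :=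
    fun x => cauchySeq_tendsto_of_complete (cauchySeq_of_le_geometric_two (hd x))
  choose g hg using hcau
  let φ : B →ₗ[ℂ] C := linearMapOfTendsto g S (tendsto_pi_nhds.2 hg)
  have hφ : ∀ x, φ x = g x := fun _ => rfl
  refine ⟨AlgHom.ofLinearMap φ ?_ ?_, ?_⟩
  · rw [hφ]
    refine tendsto_nhds_unique (hg 1) ?_
    simp only [(hP _).1]
    exact tendsto_const_nhds
  · intro x y
    rw [hφ, hφ, hφ, ← sub_eq_zero]
    refine tendsto_nhds_unique ((hg (x * y)).sub ((hg x).mul (hg y))) ?_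
    refine squeeze_zero_norm (fun n => (hP n).2.2 x y) ?_
    have : Filter.Tendsto (fun n : ℕ => (1 / 2 : ℝ) ^ n) Filter.atTop (nhds 0) :=
      tendsto_pow_atTop_nhds_zero_of_lt_one (by norm_num) (by norm_num)
    simpa using ((this.const_mul s).mul_const ‖x‖).mul_const ‖y‖
  · intro x
    have := dist_le_of_le_geometric_two_of_tendsto₀ (hd x) (hg x)
    rw [dist_comm, dist_eq_norm] at this
    exact this

theorem afp_isClosed {R : Type*} [CStarAlgebra R] (C : StarSubalgebra ℂ R)
    [FiniteDimensional ℂ C] : IsClosed (C : Set R) :=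
  Submodule.closed_of_finiteDimensional (Subalgebra.toSubmodule C.toSubalgebra)

theorem afp_kappa {B : Type*} [NormedRing B] [NormedAlgebra ℂ B] (d : AfpDiag B) :
    ∃ κ : ℝ, 1 ≤ κ ∧ ∑ i, ‖d.a i‖ * ‖d.b i‖ ≤ κ := by
  refine ⟨1 + ∑ i, ‖d.a i‖ * ‖d.b i‖, ?_, ?_⟩
  · have : 0 ≤ ∑ i, ‖d.a i‖ * ‖d.b i‖ := by positivity
    linarith
  · linarith

/-- An algebra homomorphism close to a linear map close to the inclusion. -/
theorem afp_hom_near {R : Type*} [CStarAlgebra R] [Nontrivial R] (B : StarSubalgebra ℂ R)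
    (d : AfpDiag B) (κ : ℝ) (hκ1 : 1 ≤ κ) (hκ : ∑ i, ‖d.a i‖ * ‖d.b i‖ ≤ κ)
    (η : ℝ) (hη : 0 ≤ η) (hηκ : 96 * κ ^ 2 * η ≤ 1)
    (C : StarSubalgebra ℂ R) [FiniteDimensional ℂ C] (T : B →ₗ[ℂ] C)
    (hT : ∀ x, ‖(T x : R) - x‖ ≤ η * ‖x‖) :
    ∃ φ : B →ₐ[ℂ] C, ∀ x, ‖(φ x : R) - x‖ ≤ 34 * κ * η * ‖x‖ := by
  have : CompleteSpace C := FiniteDimensional.complete ℂ C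
  obtain ⟨f, hf1, hf2⟩ := exists_dual_vector ℂ (1 : B) (by simp)
  have hnB : ‖(1 : B)‖ = 1 := by change ‖(1 : R)‖ = 1; simp
  have hf2 : f 1 = 1 := by rw [hf2, hnB]; simp
  have hη2 : 2 * η ≤ 1 / 2 := by nlinarith
  let S : B →ₗ[ℂ] C := T + (f : B →ₗ[ℂ] ℂ).smulRight (1 - T 1)
  have hS : ∀ x, (S x : R) = T x + f x • (1 - (T 1 : R)) := fun x => rfl
  have hSn : ∀ x, ‖(S x : R) - x‖ ≤ 2 * η * ‖x‖ := by
    intro x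
    rw [hS]
    have h1 : ‖f x • (1 - (T 1 : R))‖ ≤ ‖x‖ * η := by
      rw [norm_smul]
      refine mul_le_mul ?_ ?_ (norm_nonneg _) (norm_nonneg _)
      · simpa [hf1] using f.le_opNorm x
      · rw [norm_sub_rev]; simpa [hnB] using hT 1
    calc ‖(T x : R) + f x • (1 - (T 1 : R)) - x‖ = ‖((T x : R) - x) + f x • (1 - (T 1 : R))‖ := by
          congr 1; abel
      _ ≤ η * ‖x‖ + ‖x‖ * η := (norm_add_le _ _).trans (add_le_add (hT x) h1)
      _ = _ := by ring
  have hS1 : S 1 = 1 := by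
    apply Subtype.ext
    rw [hS, hf2]; simp
  have hSb : ∀ x, ‖S x‖ ≤ 3 / 2 * ‖x‖ := by
    intro x
    have h1 : ‖(S x : R)‖ ≤ ‖(S x : R) - x‖ + ‖(x : R)‖ := by
      simpa using norm_add_le ((S x : R) - x) x
    have h2 := hSn x
    have h3 : ‖(x : R)‖ = ‖x‖ := rfl
    have h4 : ‖(S x : R)‖ = ‖S x‖ := rfl
    have h5 := norm_nonneg x
    nlinarith
  obtain ⟨φ, hφ⟩ := afp_newton d κ hκ1 hκ S (8 * η) (by positivity) (by linarith) hS1 hSb (by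
    intro x y
    have e : ((S (x * y) - S x * S y : C) : R) = ((S (x * y) : R) - (x * y : B)) -
        ((S x : R) - x) * y - (S x : R) * ((S y : R) - y) := by
      push_cast
      noncomm_ring
    change ‖((S (x * y) - S x * S y : C) : R)‖ ≤ _
    rw [e]
    have b1 : ‖(S (x * y) : R) - (x * y : B)‖ ≤ 2 * η * (‖x‖ * ‖y‖) :=
      (hSn _).trans (by gcongr; exact norm_mul_le _ _)
    have b2 : ‖((S x : R) - x) * y‖ ≤ (2 * η * ‖x‖) * ‖y‖ :=
      (norm_mul_le _ _).trans (by gcongr; exact hSn x; exact le_rfl)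
    have b3 : ‖(S x : R) * ((S y : R) - y)‖ ≤ (3 / 2 * ‖x‖) * (2 * η * ‖y‖) :=
      (norm_mul_le _ _).trans (mul_le_mul (hSb x) (hSn y) (norm_nonneg _) (by positivity))
    refine (norm_sub_le _ _).trans ?_
    have b4 := norm_sub_le ((S (x * y) : R) - (x * y : B)) (((S x : R) - x) * y)
    have b5 : 0 ≤ η * ‖x‖ * ‖y‖ := by positivity
    nlinarith)
  refine ⟨φ, fun x => ?_⟩
  have h1 : ‖(φ x : R) - x‖ ≤ ‖(φ x : R) - S x‖ + ‖(S x : R) - x‖ := by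
    simpa using norm_add_le ((φ x : R) - S x) ((S x : R) - x)
  have h2 : ‖(φ x : R) - S x‖ ≤ _ := hφ x
  have h3 := hSn x
  have h4 : η * ‖x‖ ≤ κ * (η * ‖x‖) := le_mul_of_one_le_left (by positivity) hκ1
  linarith

theorem afp_perturb0 {R : Type*} [CStarAlgebra R] [Nontrivial R] (B : StarSubalgebra ℂ R)
    [FiniteDimensional ℂ B] (δ : ℝ) (hδ : 0 < δ) :
    ∃ η > 0, ∀ (C : StarSubalgebra ℂ R) [FiniteDimensional ℂ C] (T : B →ₗ[ℂ] C),
      (∀ x, ‖(T x : R) - x‖ ≤ η * ‖x‖) →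
      ∃ u ∈ unitary R, ‖u - 1‖ < δ ∧ ∀ b ∈ B, u * b * star u ∈ C := by
  obtain ⟨d⟩ := afp_exists_diag B
  obtain ⟨κ, hκ1, hκ⟩ := afp_kappa d
  obtain ⟨η, hη, hη1, hη2⟩ : ∃ η : ℝ, 0 < η ∧ 7 * (34 * κ * η) * κ ≤ 1 / 6 ∧
      8 * (7 * (34 * κ * η) * κ) < δ := by
    refine ⟨min (1 / 6) (δ / 16) / (7 * 34 * κ ^ 2), by positivity, ?_, ?_⟩
    · have : 7 * (34 * κ * (min (1 / 6) (δ / 16) / (7 * 34 * κ ^ 2))) * κ = min (1 / 6) (δ / 16) := by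
        field_simp
      rw [this]; exact min_le_left _ _
    · have : 7 * (34 * κ * (min (1 / 6) (δ / 16) / (7 * 34 * κ ^ 2))) * κ = min (1 / 6) (δ / 16) := by
        field_simp
      rw [this]
      have := min_le_right (1 / 6) (δ / 16)
      linarith
  refine ⟨η, hη, ?_⟩
  intro C _ T hT
  have hcl : IsClosed (C : Set R) := afp_isClosed C
  obtain ⟨φ, hφ⟩ := afp_hom_near B d κ hκ1 hκ η hη.le (by nlinarith) C T hT
  set θ : ℝ := 34 * κ * η with hθ
  have hθ0 : 0 < θ := by positivity
  have hθκ : θ ≤ θ * κ := le_mul_of_one_le_right hθ0.le hκ1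
  have hφb : ∀ x, ‖(φ x : R)‖ ≤ 2 * ‖x‖ := by
    intro x
    have h1 : ‖(φ x : R)‖ ≤ ‖(φ x : R) - x‖ + ‖(x : R)‖ := by
      simpa using norm_add_le ((φ x : R) - x) x
    have h2 := hφ x
    have h3 : ‖(x : R)‖ = ‖x‖ := rfl
    have h5 := norm_nonneg x
    nlinarith
  -- the adjoint homomorphism
  let ψ : B →ₗ[ℂ] C :=
    { toFun := fun x => star (φ (star x))
      map_add' := by intro x y; simp
      map_smul' := by intro c x; simp }
  have hψ : ∀ x, ψ x = star (φ (star x)) := fun _ => rfl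
  have hψmul : ∀ x y, ψ (x * y) = ψ x * ψ y := by intro x y; simp [hψ]
  have hψn : ∀ x, ‖(ψ x : R) - x‖ ≤ θ * ‖x‖ := by
    intro x
    have h1 := hφ (star x)
    have h2 : ((ψ x : R) - x) = star ((φ (star x) : R) - (star x : B)) := by
      rw [hψ]; simp
    rw [h2, norm_star]
    refine h1.trans (le_of_eq ?_)
    congr 1
    exact norm_star (x : R)
  let h0 : C := ∑ i, ψ (d.a i) * φ (d.b i)
  have hinter : ∀ x, h0 * φ x = ψ x * h0 := by
    intro x
    have := d.bilin ((LinearMap.mul ℂ C).compl₁₂ ψ φ.toLinearMap) x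
    simp only [LinearMap.compl₁₂_apply, LinearMap.mul_apply', AlgHom.toLinearMap_apply] at this
    simp only [h0, Finset.sum_mul, Finset.mul_sum]
    simp only [hψmul, map_mul] at this
    simp only [mul_assoc] at this ⊢
    exact this.symm
  have hinter' : ∀ x, star h0 * φ x = ψ x * star h0 := by
    intro x
    have := congrArg star (hinter (star x))
    simp only [star_mul, hψ, star_star] at this
    rw [hψ]
    exact this.symm
  have hh0 : ‖h0 - 1‖ ≤ 3 * θ * κ := by
    have e : ((h0 - 1 : C) : R) = ∑ i, ((ψ (d.a i) : R) * φ (d.b i) - d.a i * d.b i) := by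
      have h1 : (1 : R) = ∑ i, (d.a i : R) * d.b i := by
        have := congrArg Subtype.val d.sum_mul
        push_cast at this
        exact this.symm
      rw [Finset.sum_sub_distrib, ← h1]
      simp [h0]
    change ‖((h0 - 1 : C) : R)‖ ≤ _
    rw [e]
    calc _ ≤ ∑ i, 3 * θ * (‖d.a i‖ * ‖d.b i‖) := by
          refine norm_sum_le_of_le _ fun i _ => ?_
          have e2 : (ψ (d.a i) : R) * φ (d.b i) - d.a i * d.b i =
            ((ψ (d.a i) : R) - d.a i) * φ (d.b i) + d.a i * ((φ (d.b i) : R) - d.b i) := by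
            noncomm_ring
          rw [e2]
          have b1 : ‖((ψ (d.a i) : R) - d.a i) * φ (d.b i)‖ ≤ (θ * ‖d.a i‖) * (2 * ‖d.b i‖) :=
            (norm_mul_le _ _).trans (mul_le_mul (hψn _) (hφb _) (norm_nonneg _) (by positivity))
          have b2 : ‖(d.a i : R) * ((φ (d.b i) : R) - d.b i)‖ ≤ ‖d.a i‖ * (θ * ‖d.b i‖) :=
            (norm_mul_le _ _).trans (mul_le_mul le_rfl (hφ _) (norm_nonneg _) (by positivity))
          refine (norm_add_le _ _).trans ?_
          linarith
      _ = 3 * θ * ∑ i, ‖d.a i‖ * ‖d.b i‖ := by rw [Finset.mul_sum]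
      _ ≤ _ := by gcongr
  let h : C := (1 / 2 : ℝ) • (h0 + star h0)
  have hsa : IsSelfAdjoint h := by
    change star h = h
    simp [h, add_comm]
  have hh : ‖h - 1‖ ≤ 3 * θ * κ := by
    have e : h - 1 = (1 / 2 : ℝ) • ((h0 - 1) + star (h0 - 1)) := by
      simp only [h, star_sub, star_one]
      module
    rw [e, norm_smul]
    have := norm_add_le (h0 - 1) (star (h0 - 1))
    rw [norm_star] at this
    rw [Real.norm_of_nonneg (by norm_num)]
    linarith
  have hhinter : ∀ x, h * φ x = ψ x * h := by
    intro x
    simp only [h, smul_mul_assoc, mul_smul_comm, add_mul, mul_add, hinter, hinter']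
  obtain ⟨k, l, hk, hl, hkk, hkl, hlk, hk1, -, -⟩ := afp_sqrt_near h hsa (by nlinarith)
  have hk1 : ‖(k : R) - 1‖ ≤ 3 * θ * κ := hk1.trans hh
  let v : R := ∑ i, (φ (d.a i) : R) * d.b i
  have hv : ∀ x : B, (φ x : R) * v = v * x := by
    intro x
    have := d.bilin ((LinearMap.mul ℂ R).compl₁₂ (C.subtype.toAlgHom.comp φ).toLinearMap
      B.subtype.toAlgHom.toLinearMap) x
    simp at this
    simp only [v, Finset.sum_mul, Finset.mul_sum]
    simp only [mul_assoc] at this ⊢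
    exact this
  have hv1 : ‖v - 1‖ ≤ θ * κ := by
    have e : v - 1 = ∑ i, ((φ (d.a i) : R) - d.a i) * d.b i := by
      have h1 : (1 : R) = ∑ i, (d.a i : R) * d.b i := by
        have := congrArg Subtype.val d.sum_mul
        push_cast at this
        exact this.symm
      simp only [sub_mul]
      rw [Finset.sum_sub_distrib, ← h1]
    rw [e]
    calc _ ≤ ∑ i, θ * (‖d.a i‖ * ‖d.b i‖) := by
          refine norm_sum_le_of_le _ fun i _ => (norm_mul_le _ _).trans ?_
          rw [← mul_assoc]
          exact mul_le_mul (hφ _) le_rfl (norm_nonneg _) (by positivity)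
      _ = θ * ∑ i, ‖d.a i‖ * ‖d.b i‖ := by rw [Finset.mul_sum]
      _ ≤ _ := by gcongr
  have hvn : ‖v‖ ≤ 2 := by
    have h1 : ‖v‖ ≤ ‖v - 1‖ + ‖(1 : R)‖ := by simpa using norm_add_le (v - 1) 1
    rw [norm_one] at h1
    linarith
  have hw : ‖(k : R) * v - 1‖ ≤ 7 * θ * κ := by
    calc _ = ‖((k : R) - 1) * v + (v - 1)‖ := by congr 1; noncomm_ring
      _ ≤ ‖(k : R) - 1‖ * ‖v‖ + ‖v - 1‖ := (norm_add_le _ _).trans (by gcongr; exact norm_mul_le _ _)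
      _ ≤ (3 * θ * κ) * 2 + θ * κ := by gcongr
      _ = _ := by ring
  obtain ⟨u, hu, hun, hux⟩ := afp_polar ((k : R) * v) (hw.trans hη1)
  refine ⟨u, hu, by linarith, ?_⟩
  intro b hb
  have hlk' : (l : R) * k = 1 := congrArg Subtype.val hlk
  have hkk' : (k : R) * k = h := congrArg Subtype.val hkk
  have := hux b ((k * φ ⟨b, hb⟩ * l : C) : R) (by
      have := hv ⟨b, hb⟩
      push_cast
      calc (k : R) * v * b = k * (v * b) := by rw [mul_assoc]
        _ = k * (φ ⟨b, hb⟩ * v) := by rw [this]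
        _ = k * φ ⟨b, hb⟩ * (l * k) * v := by rw [hlk']; noncomm_ring
        _ = _ := by noncomm_ring) (by
      have := hv (star ⟨b, hb⟩)
      have h2 : (h : R) * φ (star ⟨b, hb⟩) = star (φ ⟨b, hb⟩ : R) * h := by
        have := congrArg Subtype.val (hhinter (star ⟨b, hb⟩))
        simpa [hψ] using this
      have hk' : star (k : R) = k := congrArg Subtype.val hk.star_eq
      have hl' : star (l : R) = l := congrArg Subtype.val hl.star_eq
      have h3 : ((star ⟨b, hb⟩ : B) : R) = star b := rfl
      rw [h3] at this
      push_cast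
      simp only [star_mul, hk', hl']
      calc (k : R) * v * star b = k * (v * star b) := by rw [mul_assoc]
        _ = (l * k) * k * (φ (star ⟨b, hb⟩) * v) := by rw [this, hlk', one_mul]
        _ = l * ((k * k) * φ (star ⟨b, hb⟩)) * v := by noncomm_ring
        _ = l * (star (φ ⟨b, hb⟩ : R) * (k * k)) * v := by rw [hkk', h2]
        _ = _ := by noncomm_ring)
  rw [this, mul_assoc, (Unitary.mem_iff.1 hu).2, mul_one]
  exact (k * φ ⟨b, hb⟩ * l : C).2

theorem afp_perturb {R : Type*} [CStarAlgebra R] [Nontrivial R] (B D : StarSubalgebra ℂ R)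
    [FiniteDimensional ℂ B] [FiniteDimensional ℂ D] (hDB : D ≤ B) (δ : ℝ) (hδ : 0 < δ) :
    ∃ η > 0, ∀ (C : StarSubalgebra ℂ R) [FiniteDimensional ℂ C] (T : B →ₗ[ℂ] C), D ≤ C →
      (∀ x, ‖(T x : R) - x‖ ≤ η * ‖x‖) →
      ∃ u ∈ unitary R, ‖u - 1‖ < δ ∧ (∀ b ∈ B, u * b * star u ∈ C) ∧
        ∀ x ∈ D, u * x = x * u := by
  obtain ⟨d⟩ := afp_exists_diag D
  obtain ⟨κ, hκ1, hκ⟩ := afp_kappa d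
  obtain ⟨δ₀, hδ₀, hδ1, hδ2⟩ : ∃ δ₀ : ℝ, 0 < δ₀ ∧ 2 * δ₀ * κ ≤ 1 / 6 ∧ 17 * (δ₀ * κ) < δ := by
    have e : min (1 / 12) (δ / 18) / κ * κ = min (1 / 12) (δ / 18) := by field_simp
    refine ⟨min (1 / 12) (δ / 18) / κ, by positivity, ?_, ?_⟩
    · rw [mul_assoc, e]
      have := min_le_left (1 / 12) (δ / 18)
      linarith
    · rw [e]
      have := min_le_right (1 / 12) (δ / 18)
      linarith
  obtain ⟨η, hη, H⟩ := afp_perturb0 B δ₀ hδ₀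
  refine ⟨η, hη, ?_⟩
  intro C _ T hDC hT
  obtain ⟨u, hu, hun, huB⟩ := H C T hT
  have hcl : IsClosed (C : Set R) := afp_isClosed C
  have hus := Unitary.mem_iff.1 hu
  have hun' : ‖u‖ = 1 := CStarRing.norm_of_mem_unitary hu
  have husn : ‖star u - 1‖ = ‖u - 1‖ := by rw [← norm_star (u - 1)]; simp
  let v : C := ∑ i, (⟨d.a i, hDC (d.a i).2⟩ : C) *
    ⟨u * d.b i * star u, huB _ (hDB (d.b i).2)⟩
  have hvc : (v : R) = ∑ i, (d.a i : R) * (u * d.b i * star u) := by simp [v]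
  have hv1 : ‖v - 1‖ ≤ 2 * δ₀ * κ := by
    have e : ((v - 1 : C) : R) = ∑ i, (d.a i : R) * (u * d.b i * star u - d.b i) := by
      have h1 : (1 : R) = ∑ i, (d.a i : R) * d.b i := by
        have := congrArg Subtype.val d.sum_mul
        push_cast at this
        exact this.symm
      simp only [mul_sub]
      rw [Finset.sum_sub_distrib, ← h1, ← hvc]
      rfl
    change ‖((v - 1 : C) : R)‖ ≤ _
    rw [e]
    calc _ ≤ ∑ i, 2 * δ₀ * (‖d.a i‖ * ‖d.b i‖) := by
          refine norm_sum_le_of_le _ fun i _ => (norm_mul_le _ _).trans ?_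
          have e2 : u * d.b i * star u - d.b i =
            (u - 1) * (d.b i * star u) + d.b i * (star u - 1) := by noncomm_ring
          have b1 : ‖(u - 1) * (d.b i * star u)‖ ≤ δ₀ * (‖d.b i‖ * 1) := by
            refine (norm_mul_le _ _).trans (mul_le_mul hun.le ?_ (norm_nonneg _) hδ₀.le)
            refine (norm_mul_le _ _).trans (le_of_eq ?_)
            rw [norm_star, hun']; rfl
          have b2 : ‖d.b i * (star u - 1)‖ ≤ ‖d.b i‖ * δ₀ := by
            refine (norm_mul_le _ _).trans (mul_le_mul le_rfl ?_ (norm_nonneg _) (norm_nonneg _))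
            rw [husn]; exact hun.le
          have b3 : ‖u * d.b i * star u - d.b i‖ ≤ 2 * δ₀ * ‖d.b i‖ := by
            rw [e2]
            refine (norm_add_le _ _).trans ?_
            linarith
          calc ‖(d.a i : R)‖ * ‖u * d.b i * star u - d.b i‖ ≤ ‖d.a i‖ * (2 * δ₀ * ‖d.b i‖) :=
                mul_le_mul le_rfl b3 (norm_nonneg _) (norm_nonneg _)
            _ = _ := by ring
      _ = 2 * δ₀ * ∑ i, ‖d.a i‖ * ‖d.b i‖ := by rw [Finset.mul_sum]
      _ ≤ _ := by gcongr
  have hinter : ∀ x : D, (v : R) * (u * x * star u) = x * v := by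
    intro x
    let f : D →ₗ[ℂ] D →ₗ[ℂ] R := LinearMap.mk₂ ℂ (fun a b => (a : R) * (u * b * star u))
      (by intros; push_cast; noncomm_ring)
      (by intros; simp)
      (by intros; push_cast; noncomm_ring)
      (by intros; simp)
    have := d.bilin f x
    simp only [f, LinearMap.mk₂_apply] at this
    rw [hvc, Finset.sum_mul, Finset.mul_sum]
    have e1 : ∀ i, (d.a i : R) * (u * d.b i * star u) * (u * x * star u) =
        (d.a i : R) * (u * ((d.b i * x : D) : R) * star u) := by
      intro i
      calc _ = (d.a i : R) * (u * d.b i * (star u * u) * x * star u) := by noncomm_ring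
        _ = _ := by rw [hus.1, mul_one]; push_cast; noncomm_ring
    simp only [e1]
    rw [← this]
    refine Finset.sum_congr rfl fun i _ => ?_
    push_cast
    noncomm_ring
  obtain ⟨w, hw, hwn, hwx⟩ := afp_polar v (hv1.trans hδ1)
  have hwn : ‖(w : R) - 1‖ ≤ 8 * (2 * δ₀ * κ) := hwn.trans (by gcongr)
  have hw' := Unitary.mem_iff.1 hw
  have hwR : (w : R) ∈ unitary R :=
    Unitary.mem_iff.2 ⟨congrArg Subtype.val hw'.1, congrArg Subtype.val hw'.2⟩
  refine ⟨w * u, mul_mem hwR hu, ?_, ?_, ?_⟩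
  · have e : (w : R) * u - 1 = ((w : R) - 1) * u + (u - 1) := by noncomm_ring
    rw [e]
    have h1 : ‖((w : R) - 1) * u‖ ≤ ‖(w : R) - 1‖ * 1 := by
      rw [← hun']; exact norm_mul_le _ _
    have h2 : δ₀ ≤ δ₀ * κ := le_mul_of_one_le_right hδ₀.le hκ1
    refine (norm_add_le _ _).trans_lt ?_
    linarith
  · intro b hb
    have : (w : R) * u * b * star ((w : R) * u) = w * (u * b * star u) * star (w : R) := by
      rw [star_mul]; noncomm_ring
    rw [this]
    exact mul_mem (mul_mem w.2 (huB b hb)) (star_mem w.2)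
  · intro x hx
    have := hwx ⟨u * x * star u, huB _ (hDB hx)⟩ ⟨x, hDC hx⟩
      (Subtype.ext (by simpa using hinter ⟨x, hx⟩)) (Subtype.ext (by
        have := hinter (star ⟨x, hx⟩)
        simpa [mul_assoc] using this))
    have h2 : (w : R) * (u * x * star u) = x * w := congrArg Subtype.val this
    calc (w : R) * u * x = w * (u * x * (star u * u)) := by rw [hus.1]; noncomm_ring
      _ = (w * (u * x * star u)) * u := by noncomm_ring
      _ = _ := by rw [h2, mul_assoc]

theorem afp_approx {R : Type*} [CStarAlgebra R] (Cs : ℕ → StarSubalgebra ℂ R) (hm : Monotone Cs)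
    (hd : Dense (⋃ n, (Cs n : Set R))) (B : StarSubalgebra ℂ R) [FiniteDimensional ℂ B]
    (η : ℝ) (hη : 0 < η) :
    ∃ m₀, ∀ m ≥ m₀, ∃ T : B →ₗ[ℂ] Cs m, ∀ x, ‖(T x : R) - x‖ ≤ η * ‖x‖ := by
  let e := Module.finBasis ℂ B
  let co : Fin (Module.finrank ℂ B) → (B →L[ℂ] ℂ) := fun i => LinearMap.toContinuousLinearMap (e.coord i)
  let K : ℝ := 1 + ∑ i, ‖co i‖
  have hK : 0 < K := by positivity
  have hco : ∑ i, ‖co i‖ ≤ K := by simp [K]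
  have : ∀ i, ∃ c : R, (∃ m, c ∈ Cs m) ∧ ‖c - e i‖ ≤ η / K := by
    intro i
    obtain ⟨c, hc, hc'⟩ := Metric.dense_iff.1 hd (e i : R) (η / K) (by positivity)
    refine ⟨c, by simpa using hc', ?_⟩
    rw [← dist_eq_norm]
    exact (Metric.mem_ball.1 hc).le
  choose c hc hce using this
  choose M hM using hc
  refine ⟨Finset.univ.sup M, fun m hm' => ?_⟩
  let T : B →ₗ[ℂ] Cs m := e.constr ℂ
    (fun i => ⟨c i, hm ((Finset.le_sup (Finset.mem_univ i)).trans hm') (hM i)⟩)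
  refine ⟨T, fun x => ?_⟩
  have hT : (T x : R) = ∑ i, co i x • c i := by
    simp only [T, Module.Basis.constr_apply_fintype]
    simp [co]
  have hx : (x : R) = ∑ i, co i x • (e i : R) := by
    refine (congrArg Subtype.val (e.sum_repr x)).symm.trans ?_
    rw [AddSubmonoidClass.coe_finset_sum]
    rfl
  have h2 : (T x : R) - x = ∑ i, co i x • (c i - e i) := by
    rw [hT]
    conv_lhs => rw [hx]
    rw [← Finset.sum_sub_distrib]
    simp only [smul_sub]
  rw [h2]
  calc _ ≤ ∑ i, ‖co i‖ * (‖x‖ * (η / K)) := by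
        refine norm_sum_le_of_le _ fun i _ => ?_
        rw [norm_smul, ← mul_assoc]
        exact mul_le_mul ((co i).le_opNorm x) (hce i) (norm_nonneg _) (by positivity)
    _ = (∑ i, ‖co i‖) * (‖x‖ * (η / K)) := by rw [Finset.sum_mul]
    _ ≤ K * (‖x‖ * (η / K)) := by gcongr
    _ = _ := by field_simp

/-- `Ad W ∘ β` as a star algebra automorphism. -/
noncomputable def afpAd {R : Type*} [CStarAlgebra R] (W : unitary R) (β : R ≃⋆ₐ[ℂ] R) :
    R ≃⋆ₐ[ℂ] R := β.trans (Unitary.conjStarAlgAut ℂ R W)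

theorem afpAd_apply {R : Type*} [CStarAlgebra R] (W : unitary R) (β : R ≃⋆ₐ[ℂ] R) (x : R) :
    afpAd W β x = W * β x * star (W : R) := rfl

theorem afp_map_fd {R : Type*} [CStarAlgebra R] (γ : R →⋆ₐ[ℂ] R) (S : StarSubalgebra ℂ R)
    [FiniteDimensional ℂ S] : FiniteDimensional ℂ (S.map γ) := by
  let f : S →ₗ[ℂ] (S.map γ) := ((γ : R →ₗ[ℂ] R).comp S.subtype.toAlgHom.toLinearMap).codRestrict
    (Subalgebra.toSubmodule (S.map γ).toSubalgebra) (fun x => ⟨x, x.2, rfl⟩)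
  refine Module.Finite.of_surjective f ?_
  rintro ⟨_, x, hx, rfl⟩
  exact ⟨⟨x, hx⟩, rfl⟩

theorem afp_step {R : Type*} [CStarAlgebra R] [Nontrivial R] (As : ℕ → StarSubalgebra ℂ R)
    (hmono : Monotone As) (hfd : ∀ n, FiniteDimensional ℂ (As n))
    (hdense : Dense (⋃ n, (As n : Set R))) (β : R ≃⋆ₐ[ℂ] R)
    (S : StarSubalgebra ℂ R) [FiniteDimensional ℂ S] (N : ℕ) (W : unitary R) (hSN : S ≤ As N)
    (hS : ∀ x ∈ S, afpAd W β x ∈ As N) (δ : ℝ) (hδ : 0 < δ) :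
    ∃ (S' : StarSubalgebra ℂ R) (N' : ℕ) (W' : unitary R), FiniteDimensional ℂ S' ∧ S' ≤ As N' ∧
      (∀ x ∈ S', afpAd W' β x ∈ As N') ∧ N < N' ∧ As N ≤ S' ∧ ‖(W' : R) - W‖ < δ ∧
      (∀ x ∈ S, afpAd W' β x = afpAd W β x) ∧ ∀ y ∈ As N, ∃ x ∈ S', y = afpAd W' β x := by
  have _ := hfd N
  have hmapfd := fun (W : unitary R) n => @afp_map_fd R _ (afpAd W β : R →⋆ₐ[ℂ] R) (As n) (hfd n)
  have hD1fd := afp_map_fd (afpAd W β : R →⋆ₐ[ℂ] R) S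
  have hD1 : S.map (afpAd W β : R →⋆ₐ[ℂ] R) ≤ As N := by
    rintro _ ⟨x, hx, rfl⟩
    exact hS x hx
  obtain ⟨η₁, hη₁, H₁⟩ := afp_perturb (As N) _ hD1 (δ / 2) (by positivity)
  obtain ⟨m₀, hm₀⟩ := afp_approx (fun n => (As n).map (afpAd W β : R →⋆ₐ[ℂ] R))
    (fun a b hab => StarSubalgebra.map_mono (hmono hab)) (by
      have hc : Continuous (afpAd W β) := (StarAlgEquiv.isometry (afpAd W β)).continuous
      have := (afpAd W β).surjective.denseRange.dense_image hc hdense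
      rw [Set.image_iUnion] at this
      exact this) (As N) η₁ hη₁
  set m := max m₀ N with hm
  obtain ⟨T₁, hT₁⟩ := hm₀ m (le_max_left _ _)
  have hNm : As N ≤ As m := hmono (le_max_right _ _)
  have _ := hfd m
  have _ := hmapfd W m
  obtain ⟨u, hu, hun, huB, huD⟩ := H₁ ((As m).map (afpAd W β : R →⋆ₐ[ℂ] R)) T₁
    (StarSubalgebra.map_mono (hSN.trans hNm)) hT₁
  have hus := Unitary.mem_iff.1 hu
  let W₁ : unitary R := star ⟨u, hu⟩ * W
  have hW₁ : ∀ x, afpAd W₁ β x = star u * afpAd W β x * u := by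
    intro x
    simp only [afpAd_apply, W₁]
    simp [mul_assoc]
  have hNB : As N ≤ (As m).map (afpAd W₁ β : R →⋆ₐ[ℂ] R) := by
    intro y hy
    obtain ⟨x, hx, hxy⟩ := huB y hy
    refine ⟨x, hx, ?_⟩
    change afpAd W₁ β x = y
    change afpAd W β x = _ at hxy
    rw [hW₁, hxy]
    calc _ = (star u * u) * y * (star u * u) := by noncomm_ring
      _ = y := by rw [hus.1]; simp
  have _ := hmapfd W₁ m
  obtain ⟨η₂, hη₂, H₂⟩ := afp_perturb ((As m).map (afpAd W₁ β : R →⋆ₐ[ℂ] R)) (As N) hNB (δ / 2)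
    (by positivity)
  obtain ⟨m₁, hm₁⟩ := afp_approx As hmono hdense ((As m).map (afpAd W₁ β : R →⋆ₐ[ℂ] R)) η₂ hη₂
  let N' := max m₁ (m + 1)
  have hmN' : m < N' := lt_of_lt_of_le (Nat.lt_succ_self m) (le_max_right _ _)
  obtain ⟨T₂, hT₂⟩ := hm₁ N' (le_max_left _ _)
  have _ := hfd N'
  obtain ⟨u', hu', hun', huB', huD'⟩ := H₂ (As N') T₂ (hNm.trans (hmono hmN'.le)) hT₂
  have hus' := Unitary.mem_iff.1 hu'
  let W' : unitary R := ⟨u', hu'⟩ * W₁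
  have hW' : ∀ x, afpAd W' β x = u' * afpAd W₁ β x * star u' := by
    intro x
    simp only [afpAd_apply, W']
    simp [mul_assoc]
  have hfix : ∀ y ∈ As N, u' * y * star u' = y := by
    intro y hy
    rw [huD' y hy, mul_assoc, hus'.2, mul_one]
  refine ⟨As m, N', W', hfd m, hmono hmN'.le, ?_, lt_of_le_of_lt (le_max_right _ _) hmN', hNm, ?_,
    ?_, ?_⟩
  · intro x hx
    rw [hW']
    exact huB' _ ⟨x, hx, rfl⟩
  · have e : (W' : R) - W = (u' - 1) * W₁ + star (u - 1) * W := by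
      simp only [W', W₁]
      simp [sub_mul]
    rw [e]
    have hn : ∀ V : unitary R, ‖(V : R)‖ = 1 := fun V => CStarRing.norm_of_mem_unitary V.2
    have h1 := norm_mul_le (u' - 1) (W₁ : R)
    have h2 := norm_mul_le (star (u - 1)) (W : R)
    rw [hn, mul_one] at h1 h2
    rw [norm_star] at h2
    refine (norm_add_le _ _).trans_lt ?_
    linarith
  · intro x hx
    have h1 := huD _ ⟨x, hx, rfl⟩
    change u * afpAd W β x = afpAd W β x * u at h1
    have h2 : afpAd W₁ β x = afpAd W β x := by
      rw [hW₁, mul_assoc, ← h1, ← mul_assoc, hus.1, one_mul]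
    rw [hW', h2]
    exact hfix _ (hS x hx)
  · intro y hy
    obtain ⟨x, hx, hxy⟩ := hNB hy
    change afpAd W₁ β x = y at hxy
    refine ⟨x, hx, ?_⟩
    rw [hW', hxy, hfix y hy]

/-- A stage of the intertwining construction. -/
structure AfpState {R : Type*} [CStarAlgebra R] (As : ℕ → StarSubalgebra ℂ R)
    (β : R ≃⋆ₐ[ℂ] R) where
  S : StarSubalgebra ℂ R
  N : ℕ
  W : unitary R
  fd : FiniteDimensional ℂ S
  le : S ≤ As N
  map : ∀ x ∈ S, afpAd W β x ∈ As N

theorem afp_main {R : Type*} [CStarAlgebra R] [Nontrivial R] (As : ℕ → StarSubalgebra ℂ R)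
    (hmono : Monotone As) (hfd : ∀ n, FiniteDimensional ℂ (As n))
    (hdense : Dense (⋃ n, (As n : Set R))) (β : R ≃⋆ₐ[ℂ] R) (ε : ℝ) (hε : 0 < ε) :
    ∃ (ns : ℕ → ℕ) (U : R), StrictMono ns ∧ (∀ k, 0 < ns k) ∧ U ∈ unitary R ∧ ‖U - 1‖ < ε ∧
      (∀ k, ∀ x ∈ As (ns k), U * β x * star U ∈ As (ns (k + 1))) ∧
      ∀ k, ∀ x ∈ As (ns k), ∃ y ∈ As (ns (k + 1)), x = U * β y * star U := by
  have step : ∀ (k : ℕ) (s : AfpState As β), ∃ s' : AfpState As β, s.N < s'.N ∧ As s.N ≤ s'.S ∧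
      ‖(s'.W : R) - s.W‖ < ε / 2 / 2 / 2 ^ k ∧ (∀ x ∈ s.S, afpAd s'.W β x = afpAd s.W β x) ∧
      ∀ y ∈ As s.N, ∃ x ∈ s'.S, y = afpAd s'.W β x := by
    intro k s
    have _ := s.fd
    obtain ⟨S', N', W', h1, h2, h3, h4⟩ := afp_step As hmono hfd hdense β s.S s.N s.W s.le s.map
      (ε / 2 / 2 / 2 ^ k) (by positivity)
    exact ⟨⟨S', N', W', h1, h2, h3⟩, h4⟩
  choose F hF1 hF2 hF3 hF4 hF5 using step
  let s0 : AfpState As β :=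
    { S := ⊥
      N := 1
      W := 1
      fd := by
        have : Function.Surjective (Algebra.linearMap ℂ (⊥ : StarSubalgebra ℂ R)) := by
          rintro ⟨x, hx⟩
          obtain ⟨c, rfl⟩ := StarSubalgebra.mem_bot.1 hx
          exact ⟨c, rfl⟩
        exact Module.Finite.of_surjective _ this
      le := bot_le
      map := by
        intro x hx
        obtain ⟨c, rfl⟩ := StarSubalgebra.mem_bot.1 hx
        have : afpAd 1 β (algebraMap ℂ R c) = algebraMap ℂ R c := by
          rw [Algebra.algebraMap_eq_smul_one, map_smul, map_one]
        rw [this]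
        exact algebraMap_mem _ _ }
  let s : ℕ → AfpState As β := fun k => Nat.rec s0 (fun k t => F k t) k
  have hs0 : s 0 = s0 := rfl
  have hss : ∀ k, s (k + 1) = F k (s k) := fun _ => rfl
  have hN : StrictMono fun k => (s k).N := strictMono_nat_of_lt_succ fun k => by
    rw [hss]; exact hF1 k _
  have hSmono : Monotone fun k => (s k).S := monotone_nat_of_le_succ fun k => by
    rw [hss]; exact (s k).le.trans (hF2 k _)
  have hd : ∀ k, dist ((s k).W : R) ((s (k + 1)).W : R) ≤ ε / 2 / 2 / 2 ^ k := by
    intro k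
    rw [dist_comm, dist_eq_norm, hss]
    exact (hF3 k _).le
  obtain ⟨U, hU⟩ := cauchySeq_tendsto_of_complete (cauchySeq_of_le_geometric_two hd)
  have hUs : Filter.Tendsto (fun k => star ((s k).W : R)) Filter.atTop (nhds (star U)) := hU.star
  have hfix : ∀ k, ∀ x ∈ (s k).S, U * β x * star U = afpAd (s k).W β x := by
    intro k x hx
    have hj : ∀ j, afpAd (s (k + j)).W β x = afpAd (s k).W β x := by
      intro j
      induction j with
      | zero => rfl
      | succ j ih =>
        rw [← add_assoc, hss, hF4 _ _ x (hSmono (Nat.le_add_right k j) hx), ih]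
    have ht : Filter.Tendsto (fun k => afpAd (s k).W β x) Filter.atTop
        (nhds (U * β x * star U)) := (hU.mul_const _).mul hUs
    refine tendsto_nhds_unique ht ?_
    refine tendsto_const_nhds.congr' ?_
    filter_upwards [Filter.eventually_ge_atTop k] with n hn
    obtain ⟨j, rfl⟩ := Nat.exists_eq_add_of_le hn
    exact (hj j).symm
  refine ⟨fun k => (s k).N, U, hN, ?_, ?_, ?_, ?_, ?_⟩
  · intro k
    have h1 : (s 0).N ≤ (s k).N := hN.monotone (Nat.zero_le k)
    have h2 : (s 0).N = 1 := rfl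
    exact lt_of_lt_of_le (h2 ▸ Nat.one_pos) h1
  · rw [Unitary.mem_iff]
    constructor
    · refine tendsto_nhds_unique (hUs.mul hU) ?_
      simp only [fun k => (Unitary.mem_iff.1 (s k).W.2).1]
      exact tendsto_const_nhds
    · refine tendsto_nhds_unique (hU.mul hUs) ?_
      simp only [fun k => (Unitary.mem_iff.1 (s k).W.2).2]
      exact tendsto_const_nhds
  · have := dist_le_of_le_geometric_two_of_tendsto₀ hd hU
    rw [dist_comm, dist_eq_norm] at this
    have h2 : ((s 0).W : R) = 1 := rfl
    rw [h2] at this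
    linarith
  · intro k x hx
    have hx' : x ∈ (s (k + 1)).S := by rw [hss]; exact hF2 k _ hx
    rw [hfix (k + 1) x hx']
    exact (s (k + 1)).map x hx'
  · intro k y hy
    obtain ⟨x, hx, hxy⟩ := hF5 k _ y hy
    rw [← hss] at hx hxy
    exact ⟨x, (s (k + 1)).le hx, by rw [hfix (k + 1) x hx, hxy]⟩

/-- The unitization of a star subalgebra, inside the unitization. -/
def afpTilde {A : Type*} [NonUnitalCStarAlgebra A] (S : NonUnitalStarSubalgebra ℂ A) :
    StarSubalgebra ℂ (Unitization ℂ A) where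
  carrier := {x | x.snd ∈ S}
  mul_mem' := by
    intro x y hx hy
    simp only [Set.mem_ofPred_eq, Unitization.snd_mul] at *
    exact add_mem (add_mem (SMulMemClass.smul_mem _ hy) (SMulMemClass.smul_mem _ hx))
      (mul_mem hx hy)
  add_mem' := by
    intro x y hx hy
    simp only [Set.mem_ofPred_eq, Unitization.snd_add] at *
    exact add_mem hx hy
  algebraMap_mem' := by
    intro c
    simp [Unitization.algebraMap_eq_inl]
  star_mem' := by
    intro x hx
    simp only [Set.mem_ofPred_eq, Unitization.snd_star] at *
    exact star_mem hx

theorem afp_mem_tilde {A : Type*} [NonUnitalCStarAlgebra A] (S : NonUnitalStarSubalgebra ℂ A)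
    (x : Unitization ℂ A) : x ∈ afpTilde S ↔ x.snd ∈ S := Iff.rfl

theorem afp_tilde_fd {A : Type*} [NonUnitalCStarAlgebra A] (S : NonUnitalStarSubalgebra ℂ A)
    [FiniteDimensional ℂ S] : FiniteDimensional ℂ (afpTilde S) := by
  let f : (ℂ × S) →ₗ[ℂ] afpTilde S :=
    { toFun := fun p => ⟨Unitization.inl p.1 + Unitization.inr (p.2 : A), by
        rw [afp_mem_tilde]; simp⟩
      map_add' := by
        intro p q
        apply Subtype.ext
        apply Unitization.ext <;> simp
      map_smul' := by
        intro c p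
        apply Subtype.ext
        apply Unitization.ext <;> simp }
  refine Module.Finite.of_surjective f ?_
  rintro ⟨x, hx⟩
  exact ⟨(x.fst, ⟨x.snd, hx⟩), Subtype.ext (Unitization.inl_fst_add_inr_snd_eq x)⟩

/-- The extension of an automorphism to the unitization, as a star algebra equivalence. -/
noncomputable def afpExt {A : Type*} [NonUnitalCStarAlgebra A] (α : A ≃⋆ₐ[ℂ] A) :
    Unitization ℂ A ≃⋆ₐ[ℂ] Unitization ℂ A :=
  StarAlgEquiv.ofStarAlgHom (Unitization.starMap (α : A →⋆ₙₐ[ℂ] A))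
    (Unitization.starMap (α.symm : A →⋆ₙₐ[ℂ] A))
    (by ext <;> simp) (by ext <;> simp)

theorem afpExt_inr {A : Type*} [NonUnitalCStarAlgebra A] (α : A ≃⋆ₐ[ℂ] A) (x : A) :
    afpExt α (x : Unitization ℂ A) = (α x : A) := by
  change Unitization.starMap (α : A →⋆ₙₐ[ℂ] A) (x : Unitization ℂ A) = _
  simp

theorem afpExt_fst {A : Type*} [NonUnitalCStarAlgebra A] (α : A ≃⋆ₐ[ℂ] A)
    (x : Unitization ℂ A) : (afpExt α x).fst = x.fst := by
  change (Unitization.starMap (α : A →⋆ₙₐ[ℂ] A) x).fst = _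
  simp [Unitization.algebraMap_eq_inl]

end AfpHelpers

/-- Remark 2.3. -/
theorem exists_unitary_perturbation_mapping_subalgebras
    (As : ℕ → NonUnitalStarSubalgebra ℂ A)
    (hmono : Monotone As)
    (hfd : ∀ n, FiniteDimensional ℂ (As n))
    (hdense : Dense (⋃ n, (As n : Set A)))
    (α : A ≃⋆ₐ[ℂ] A) (ε : ℝ) (hε : 0 < ε) :
    ∃ (ns : ℕ → ℕ) (U : Unitization ℂ A),
      StrictMono ns ∧ (∀ k, 0 < ns k) ∧
      U ∈ unitary (Unitization ℂ A) ∧ ‖U - 1‖ < ε ∧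
      (∀ k, ∀ x ∈ As (ns k), ∃ y ∈ As (ns (k + 1)),
        (↑y : Unitization ℂ A) = U * (↑(α x) : Unitization ℂ A) * star U) ∧
      (∀ k, ∀ x ∈ As (ns k), ∃ y ∈ As (ns (k + 1)),
        (↑x : Unitization ℂ A) = U * (↑(α y) : Unitization ℂ A) * star U) := by
  have hdense' : Dense (⋃ n, (afpTilde (As n) : Set (Unitization ℂ A))) := by
    have hc : Continuous fun p : ℂ × A => (Unitization.inl p.1 + Unitization.inr p.2 : Unitization ℂ A) := by
      have h1 : Continuous fun c : ℂ => (Unitization.inl c : Unitization ℂ A) :=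
        (continuous_algebraMap ℂ (Unitization ℂ A))
      have h2 : Continuous fun a : A => (a : Unitization ℂ A) :=
        (Unitization.isometry_inr (𝕜 := ℂ) (A := A)).continuous
      exact (h1.comp continuous_fst).add (h2.comp continuous_snd)
    have hs : Function.Surjective
        fun p : ℂ × A => (Unitization.inl p.1 + Unitization.inr p.2 : Unitization ℂ A) :=
      fun x => ⟨(x.fst, x.snd), Unitization.inl_fst_add_inr_snd_eq x⟩
    refine (hs.denseRange.dense_image hc (dense_univ.prod hdense)).mono ?_
    rintro _ ⟨⟨c, a⟩, ⟨-, ha⟩, rfl⟩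
    obtain ⟨n, hn⟩ := Set.mem_iUnion.1 ha
    refine Set.mem_iUnion.2 ⟨n, ?_⟩
    change _ ∈ afpTilde (As n)
    rw [afp_mem_tilde]
    simpa using hn
  obtain ⟨ns, U, h1, h2, h3, h4, h5, h6⟩ := afp_main (fun n => afpTilde (As n))
    (fun a b hab x hx => hmono hab hx) (fun n => @afp_tilde_fd A _ (As n) (hfd n)) hdense'
    (afpExt α) ε hε
  refine ⟨ns, U, h1, h2, h3, h4, ?_, ?_⟩
  · intro k x hx
    have := h5 k (x : Unitization ℂ A) (by rw [afp_mem_tilde]; simpa using hx)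
    rw [afpExt_inr, afp_mem_tilde] at this
    refine ⟨_, this, ?_⟩
    apply Unitization.ext <;> simp
  · intro k x hx
    obtain ⟨y, hy, hxy⟩ := h6 k (x : Unitization ℂ A) (by rw [afp_mem_tilde]; simpa using hx)
    have hf : y.fst = 0 := by
      have e1 := congrArg (fun z : Unitization ℂ A => z.fst) hxy
      have e2 := congrArg (fun z : Unitization ℂ A => z.fst) (Unitary.mem_iff.1 h3).1
      have e3 := congrArg (fun z : Unitization ℂ A => z.fst) (Unitary.mem_iff.1 h3).2
      simp only [Unitization.fst_mul, Unitization.fst_inr, Unitization.fst_star, afpExt_fst,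
        Unitization.fst_one] at e1 e2 e3
      calc y.fst = (U.fst * star U.fst) * y.fst := by rw [e3, one_mul]
        _ = U.fst * y.fst * star U.fst := by ring
        _ = 0 := e1.symm
    have hy2 : y = (y.snd : A) := by
      apply Unitization.ext <;> simp [hf]
    refine ⟨y.snd, hy, ?_⟩
    rw [hy2, afpExt_inr] at hxy
    exact hxy
end

section
/- Let A be a C*-algebra given with an increasing sequence (A_n) of finite-dimensional *-subalgebras whose union is dense in A, let B be a finite-dimensional *-subalgebra of A, and let ε > 0. Then there exist n ∈ ℕ and a unitary U in A + ℂ1 such that ‖U − 1‖ < ε and U B U* ⊆ A_n. -/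
section
variable {A : Type*} [CStarAlgebra A]

/-- spectral cut-off -/
lemma afAux_cut (x : A) (hx : IsSelfAdjoint x) (hd : ‖x * x - x‖ < 1/4) :
    ∃ g k : A, IsSelfAdjoint g ∧ IsSelfAdjoint k ∧ k * k = k ∧ g * x * g = k ∧ g * x = x * g ∧
      ‖g - k‖ ≤ 4 * ‖x * x - x‖ ∧ ‖k - x‖ ≤ 2 * ‖x * x - x‖ ∧ 
      (∀ S : NonUnitalStarSubalgebra ℂ A, IsClosed (S : Set A) → x ∈ S → g ∈ S ∧ k ∈ S) := by
  set d := ‖x * x - x‖ with hd'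
  have hspec : ∀ t ∈ quasispectrum ℝ x, |t * t - t| ≤ d := by
    intro t ht
    have h1 : cfcₙ (fun t : ℝ => t * t - t) x = x * x - x := by
      rw [cfcₙ_sub _ _ x, cfcₙ_mul _ _ x, cfcₙ_id' ℝ x]
    have := norm_apply_le_norm_cfcₙ (fun t : ℝ => t * t - t) x ht
    rwa [h1] at this
  let f : ℝ → ℝ := fun t => if t < 1/2 then 0 else 1
  let h : ℝ → ℝ := fun t => if t < 1/2 then 0 else (√t)⁻¹
  have hne : ∀ t ∈ quasispectrum ℝ x, t ≠ 1/2 := by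
    intro t ht h0
    have := hspec t ht
    rw [h0] at this
    norm_num at this
    linarith
  have hev : ∀ t : ℝ, t ≠ 1/2 → (∀ᶠ s in nhds t, s < 1/2) ∨ ((∀ᶠ s in nhds t, 1/2 < s) ∧ 1/2 < t) := by
    intro t ht
    rcases lt_or_gt_of_ne ht with h | h
    · exact Or.inl (eventually_lt_nhds h)
    · exact Or.inr ⟨eventually_gt_nhds h, h⟩
  have hfc : ContinuousOn f (quasispectrum ℝ x) := by
    intro t ht
    apply ContinuousAt.continuousWithinAt
    rcases hev t (hne t ht) with h1 | ⟨h1, _⟩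
    · refine (continuousAt_const (y := (0:ℝ))).congr ?_
      filter_upwards [h1] with s hs
      simp only [f]; rw [if_pos hs]
    · refine (continuousAt_const (y := (1:ℝ))).congr ?_
      filter_upwards [h1] with s hs
      simp only [f]; rw [if_neg (not_lt.2 hs.le)]
  have hhc : ContinuousOn h (quasispectrum ℝ x) := by
    intro t ht
    apply ContinuousAt.continuousWithinAt
    rcases hev t (hne t ht) with h1 | ⟨h1, h2⟩
    · refine (continuousAt_const (y := (0:ℝ))).congr ?_
      filter_upwards [h1] with s hs
      simp only [h]; rw [if_pos hs]
    · have : ContinuousAt (fun s : ℝ => (√s)⁻¹) t := by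
        apply ContinuousAt.inv₀ (by fun_prop)
        positivity
      refine this.congr ?_
      filter_upwards [h1] with s hs
      simp only [h]; rw [if_neg (not_lt.2 hs.le)]
  have hf0 : f 0 = 0 := by simp [f]
  have hh0 : h 0 = 0 := by simp [h]
  have hsa : ∀ u : ℝ → ℝ, IsSelfAdjoint (cfcₙ u x) := fun u => cfcₙ_predicate u x
  refine ⟨cfcₙ h x, cfcₙ f x, hsa _, hsa _, ?_, ?_, ?_, ?_, ?_, ?_⟩
  · rw [← cfcₙ_mul f f x]
    apply cfcₙ_congr
    intro t ht
    simp only [f]; split_ifs <;> simp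
  · have : cfcₙ h x * x * cfcₙ h x = cfcₙ (fun t => h t * t * h t) x := by
      rw [cfcₙ_mul _ _ x, cfcₙ_mul _ _ x, cfcₙ_id' ℝ x]
    rw [this]
    apply cfcₙ_congr
    intro t ht
    simp only [f, h]; split_ifs with h1
    · simp
    · have h2 : 0 < t := by linarith [not_lt.1 h1]
      have h3 := Real.mul_self_sqrt h2.le
      have h4 : 0 < √t := by positivity
      field_simp
      nlinarith
  · have := cfcₙ_commute_cfcₙ h (fun t => t) x
    rw [cfcₙ_id' ℝ x] at this
    exact this
  · rw [← cfcₙ_sub h f x]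
    apply norm_cfcₙ_le
    intro t ht
    have ht' := hspec t ht
    simp only [f, h]; split_ifs with h1
    · simp; positivity
    · have h2 : 1/2 ≤ t := not_lt.1 h1
      have h3 := Real.mul_self_sqrt (show 0 ≤ t by linarith)
      have h4 : 1/2 ≤ √t := Real.le_sqrt_of_sq_le (by linarith)
      have h5 : (√t)⁻¹ - 1 = (1 - √t) / √t := by field_simp
      have h6 : t * t - t = - (t * (1 + √t) * (1 - √t)) := by linear_combination (-t) * h3
      rw [Real.norm_eq_abs, h5, abs_div, abs_of_pos (show 0 < √t by linarith)]
      rw [h6, abs_neg, abs_mul, abs_of_pos (by positivity)] at ht'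
      rw [div_le_iff₀ (by linarith)]
      have h7 := abs_nonneg (1 - √t)
      have h8 : |1 - √t| * (1/2) ≤ d := by
        have h9 : 1/2 ≤ t * (1 + √t) := by nlinarith
        exact le_trans (by nlinarith [mul_le_mul_of_nonneg_right h9 h7]) ht'
      nlinarith
  · nth_rewrite 2 [← cfcₙ_id' ℝ x]
    rw [← cfcₙ_sub f _ x]
    apply norm_cfcₙ_le
    intro t ht
    have ht' := hspec t ht
    have h6 : t * t - t = t * (t - 1) := by ring
    rw [h6, abs_mul] at ht'
    rw [Real.norm_eq_abs]
    simp only [f]; split_ifs with h1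
    · have : 1/2 ≤ |t - 1| := by rw [abs_sub_comm]; exact le_trans (by linarith) (le_abs_self _)
      rw [zero_sub, abs_neg]
      nlinarith [abs_nonneg t]
    · have : 1/2 ≤ |t| := le_trans (not_lt.1 h1) (le_abs_self _)
      rw [abs_sub_comm]
      nlinarith [abs_nonneg (t-1)]
  · intro S hS hxS
    exact ⟨cfcₙ_mem (𝕜' := ℂ) (hs := hS) h hxS, cfcₙ_mem (𝕜' := ℂ) (hs := hS) f hxS⟩

lemma afAux_finite (B : NonUnitalStarSubalgebra ℂ A) (hB : FiniteDimensional ℂ B) (x : A)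
    (hx : x ∈ B) : (quasispectrum ℝ x).Finite := by
  have hp : ∀ k : ℕ, x ^ (k+1) ∈ B := by
    intro k
    induction k with
    | zero => simpa using hx
    | succ k ih => rw [pow_succ]; exact mul_mem ih hx
  have hnl : ¬ LinearIndependent ℂ (fun k : ℕ => (⟨x ^ (k+1), hp k⟩ : B)) := by
    intro h
    have := h.finite
    exact not_finite ℕ
  rw [linearIndependent_iff] at hnl
  push Not at hnl
  obtain ⟨l, hl, hl0⟩ := hnl
  let P : Polynomial ℂ := ∑ i ∈ l.support, Polynomial.C (l i) * Polynomial.X ^ (i+1)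
  have hP0 : P ≠ 0 := by
    intro h
    apply hl0
    ext i
    have h1 := congrArg (fun Q => Polynomial.coeff Q (i+1)) h
    simpa [P, Polynomial.finsetSum_coeff, Polynomial.coeff_X_pow] using h1
  have hPx : Polynomial.aeval x P = 0 := by
    have := congrArg (Subtype.val) hl
    rw [Finsupp.linearCombination_apply, Finsupp.sum] at this
    simp only [AddSubmonoidClass.coe_finsetSum, ZeroMemClass.coe_zero] at this
    rw [← this]
    simp only [P, map_sum]
    apply Finset.sum_congr rfl
    intro i _
    simp [Algebra.smul_def]
  have hroots : (P.roots.toFinset : Set ℂ).Finite := Finset.finite_toSet _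
  have : Set.Finite ((algebraMap ℝ ℂ) ⁻¹' (P.roots.toFinset : Set ℂ)) := 
    hroots.preimage (Complex.ofReal_injective.injOn)
  refine this.subset ?_
  intro t ht
  rw [quasispectrum_eq_spectrum_union_zero] at ht
  simp only [Set.mem_preimage, Finset.mem_coe, Multiset.mem_toFinset, Polynomial.mem_roots hP0]
  rcases ht with ht | ht
  · have h1 : (algebraMap ℝ ℂ t) ∈ spectrum ℂ x := spectrum.algebraMap_mem ℂ ht
    have h2 := spectrum.subset_polynomial_aeval x P (Set.mem_image_of_mem _ h1)
    rw [hPx] at h2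
    by_contra h3
    apply h2
    have : IsUnit (algebraMap ℂ A (P.eval (algebraMap ℝ ℂ t))) := 
      (isUnit_iff_ne_zero.2 h3).map (algebraMap ℂ A)
    simpa [spectrum.mem_resolventSet_iff] using this
  · have : t = 0 := ht
    simp [this, P, Polynomial.eval_finsetSum]

/-- nonzero spectral projection -/
lemma afAux_eigen (B : NonUnitalStarSubalgebra ℂ A) (hB : FiniteDimensional ℂ B) (x : A)
    (hx : x ∈ B) (hsa : IsSelfAdjoint x) (hx0 : x ≠ 0) :
    ∃ (e : A) (c : ℝ), e ∈ B ∧ IsSelfAdjoint e ∧ e * e = e ∧ e ≠ 0 ∧ c ≠ 0 ∧ x * e = (c:ℂ) • e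
      ∧ e * x = (c:ℂ) • e := by
  have hfin := afAux_finite B hB x hx
  have hBc : IsClosed (B : Set A) := B.toSubmodule.closed_of_finiteDimensional
  have : ∃ c ∈ quasispectrum ℝ x, c ≠ 0 := by
    by_contra! h
    exact hx0 (CFC.eq_zero_of_quasispectrum_eq_zero (R := ℝ) x (fun t ht => h t ht))
  obtain ⟨c, hc, hc0⟩ := this
  let f : ℝ → ℝ := fun t => if t = c then 1 else 0
  have hf : ContinuousOn f (quasispectrum ℝ x) := by
    have := hfin.isDiscrete
    exact hfin.continuousOn f
  have hf0 : f 0 = 0 := by simp [f, hc0.symm]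
  have hxe : x * cfcₙ f x = (c:ℂ) • cfcₙ f x := by
    have h1 : x * cfcₙ f x = cfcₙ (fun t => t * f t) x := by
      rw [cfcₙ_mul _ _ x, cfcₙ_id' ℝ x]
    have h2 : (c:ℂ) • cfcₙ f x = cfcₙ (fun t => c * f t) x := by
      rw [cfcₙ_const_mul c f x]; simp
    rw [h1, h2]
    apply cfcₙ_congr
    intro t ht
    simp only [f]; split_ifs with h <;> simp [h]
  have hs : IsSelfAdjoint (cfcₙ f x) := cfcₙ_predicate f x
  refine ⟨cfcₙ f x, c, cfcₙ_mem (𝕜' := ℂ) (hs := hBc) f hx, hs, ?_, ?_, hc0, hxe, ?_⟩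
  · rw [← cfcₙ_mul f f x]
    apply cfcₙ_congr
    intro t ht
    simp only [f]; split_ifs <;> simp
  · intro h
    have := norm_apply_le_norm_cfcₙ f x hc
    rw [h] at this
    norm_num [f] at this
  · have := congrArg star hxe
    simpa [hs.star_eq, hsa.star_eq] using this
end
section
variable {A : Type*} [CStarAlgebra A]

lemma afAux_scalar_sa (B : NonUnitalStarSubalgebra ℂ A) (hB : FiniteDimensional ℂ B) (p : A)
    (hpp : p * p = p)
    (hmin : ∀ e ∈ B, IsSelfAdjoint e → e * e = e → p * e = e → e ≠ 0 → e = p)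
    (x : A) (hx : x ∈ B) (hsa : IsSelfAdjoint x) (hpx : p * x * p = x) :
    ∃ c : ℝ, x = (c : ℂ) • p := by
  by_cases hx0 : x = 0
  · exact ⟨0, by simp [hx0]⟩
  obtain ⟨e, c, heB, hes, hee, he0, hc, hxe, -⟩ := afAux_eigen B hB x hx hsa hx0
  have h1 : p * x = x := by rw [← hpx, ← mul_assoc, ← mul_assoc, hpp]
  have h2 : x * p = x := by rw [← hpx, mul_assoc, hpp]
  have h3 : p * e = e := by
    have h4 : (c:ℂ) • (p * e) = (c:ℂ) • e := by
      rw [← mul_smul_comm, ← hxe, ← mul_assoc, h1]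
    exact smul_right_injective A (by exact_mod_cast hc : (c:ℂ) ≠ 0) h4
  have h5 := hmin e heB hes hee h3 he0
  exact ⟨c, by rw [← h5, ← hxe, h5, h2]⟩

lemma afAux_scalar (B : NonUnitalStarSubalgebra ℂ A) (hB : FiniteDimensional ℂ B) (p : A)
    (hps : IsSelfAdjoint p) (hpp : p * p = p)
    (hmin : ∀ e ∈ B, IsSelfAdjoint e → e * e = e → p * e = e → e ≠ 0 → e = p)
    (x : A) (hx : x ∈ B) (hpx : p * x * p = x) :
    ∃ c : ℂ, x = c • p := by
  have hpx' : p * star x * p = star x := by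
    have := congrArg star hpx
    simpa [hps.star_eq, mul_assoc] using this
  obtain ⟨c, hc⟩ := afAux_scalar_sa B hB p hpp hmin (x + star x) (add_mem hx (star_mem hx))
    (by simp [IsSelfAdjoint, add_comm]) (by rw [mul_add, add_mul, hpx, hpx'])
  obtain ⟨d, hd⟩ := afAux_scalar_sa B hB p hpp hmin (Complex.I • (x - star x))
    (SMulMemClass.smul_mem _ (sub_mem hx (star_mem hx)))
    (by simp [IsSelfAdjoint, smul_sub]; abel) 
    (by rw [mul_smul_comm, smul_mul_assoc, mul_sub, sub_mul, hpx, hpx'])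
  refine ⟨(1/2) * c - (Complex.I/2) * d, ?_⟩
  rw [sub_smul, mul_smul, mul_smul, ← hc, ← hd, smul_smul]
  have : Complex.I / 2 * Complex.I = -1/2 := by
    linear_combination (1/2) * Complex.I_mul_I
  rw [this]
  module

lemma afAux_equiv (B : NonUnitalStarSubalgebra ℂ A) (hB : FiniteDimensional ℂ B) (p q : A)
    (hpB : p ∈ B) (hqB : q ∈ B)
    (hps : IsSelfAdjoint p) (hpp : p * p = p)
    (hmin : ∀ e ∈ B, IsSelfAdjoint e → e * e = e → p * e = e → e ≠ 0 → e = p)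
    (hqs : IsSelfAdjoint q) (hqq : q * q = q)
    (hminq : ∀ e ∈ B, IsSelfAdjoint e → e * e = e → q * e = e → e ≠ 0 → e = q)
    (b : A) (hb : b ∈ B) (h0 : q * b * p ≠ 0) :
    ∃ v ∈ B, star v * v = p ∧ v * star v = q := by
  set y := q * b * p with hy
  have hyB : y ∈ B := mul_mem (mul_mem hqB hb) hpB
  have hyp : y * p = y := by rw [hy, mul_assoc, hpp]
  have hqy : q * y = y := by rw [hy, ← mul_assoc, ← mul_assoc, hqq]
  have hpy : p * star y = star y := by
    have := congrArg star hyp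
    simpa [hps.star_eq] using this
  obtain ⟨c, hc⟩ := afAux_scalar_sa B hB p hpp hmin (star y * y) (mul_mem (star_mem hyB) hyB)
    (IsSelfAdjoint.star_mul_self y) (by rw [← mul_assoc, hpy, mul_assoc, hyp])
  have hyy : star y * y ≠ 0 := by
    intro h; exact h0 (CStarRing.star_mul_self_eq_zero_iff y |>.1 h)
  have hc0 : 0 < c := by
    by_contra! hneg
    let _ := CStarAlgebra.spectralOrder A
    have _ := CStarAlgebra.spectralOrderedRing A
    have h1 : 0 ≤ star y * y := star_mul_self_nonneg y
    have h2 : 0 ≤ - (star y * y) := by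
      have : - (star y * y) = star (((√(-c) : ℝ) : ℂ) • p) * (((√(-c) : ℝ) : ℂ) • p) := by
        rw [hc, star_smul, hps.star_eq, smul_mul_smul_comm, hpp, ← neg_smul]
        congr 1
        have := Real.mul_self_sqrt (show 0 ≤ -c by linarith)
        simp only [RCLike.star_def, Complex.conj_ofReal]
        rw [← Complex.ofReal_mul, this]; simp
      rw [this]
      exact star_mul_self_nonneg _
    exact hyy (le_antisymm (neg_nonneg.1 h2) h1)
  have hsq : √c * √c = c := Real.mul_self_sqrt hc0.le
  have hs0 : √c ≠ 0 := (Real.sqrt_pos.2 hc0).ne'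
  have hvv : star ((((√c)⁻¹ : ℝ) : ℂ) • y) * ((((√c)⁻¹ : ℝ) : ℂ) • y) = p := by
    rw [star_smul, smul_mul_smul_comm, hc, smul_smul]
    simp only [RCLike.star_def, Complex.conj_ofReal]
    rw [← Complex.ofReal_mul, ← Complex.ofReal_mul]
    have : (√c)⁻¹ * (√c)⁻¹ * c = 1 := by
      rw [← mul_inv, hsq, inv_mul_cancel₀ hc0.ne']
    rw [this]; simp
  set v := (((√c)⁻¹ : ℝ) : ℂ) • y with hv
  have hvB : v ∈ B := SMulMemClass.smul_mem _ hyB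
  have hvp : v * p = v := by rw [hv, smul_mul_assoc, hyp]
  have hqv : q * v = v := by rw [hv, mul_smul_comm, hqy]
  refine ⟨v, hvB, hvv, ?_⟩
  apply hminq _ (mul_mem hvB (star_mem hvB)) (IsSelfAdjoint.mul_star_self v)
  · rw [mul_assoc, ← mul_assoc (star v), hvv, ← mul_assoc, hvp]
  · rw [← mul_assoc, hqv]
  · intro h
    have hv0 := CStarRing.mul_star_self_eq_zero_iff v |>.1 h
    rw [hv0] at hvv
    rw [← hvv] at hyp
    simp at hyp
    exact h0 hyp.symm

/-- orthogonal families of nonzero projections in `B` -/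
def AfAuxGood (B : NonUnitalStarSubalgebra ℂ A) (s : Finset A) : Prop :=
  (∀ p ∈ s, p ∈ B ∧ IsSelfAdjoint p ∧ p * p = p ∧ p ≠ 0) ∧
  ∀ p ∈ s, ∀ q ∈ s, p ≠ q → p * q = 0

lemma AfAuxGood.card_le {B : NonUnitalStarSubalgebra ℂ A} (hB : FiniteDimensional ℂ B)
    {s : Finset A} (h : AfAuxGood B s) : s.card ≤ Module.finrank ℂ B := by
  have hli : LinearIndependent ℂ (fun p : s => (⟨p.1, (h.1 p.1 p.2).1⟩ : B)) := by
    rw [Fintype.linearIndependent_iff]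
    intro g hg i
    have h1 := congrArg (fun z : B => (z : A) * (i : A)) hg
    simp only [AddSubmonoidClass.coe_finsetSum, Finset.sum_mul] at h1
    rw [Finset.sum_eq_single i] at h1
    · simp [(h.1 i i.2).2.2.1, (h.1 i i.2).2.2.2] at h1
      exact h1
    · intro j _ hj
      simp [h.2 j j.2 i i.2 (fun h => hj (Subtype.ext h))]
    · simp
  simpa using hli.fintype_card_le_finrank

lemma afAux_max (B : NonUnitalStarSubalgebra ℂ A) (hB : FiniteDimensional ℂ B) :
    ∃ s : Finset A, AfAuxGood B s ∧ 
      (∀ p ∈ s, ∀ e ∈ B, IsSelfAdjoint e → e * e = e → p * e = e → e ≠ 0 → e = p) ∧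
      (∀ b ∈ B, b * (∑ p ∈ s, p) = b) := by
  classical
  have hne : {n | ∃ s : Finset A, AfAuxGood B s ∧ s.card = n}.Nonempty :=
    ⟨0, ∅, ⟨by simp, by simp⟩, rfl⟩
  have hbdd : BddAbove {n | ∃ s : Finset A, AfAuxGood B s ∧ s.card = n} := by
    refine ⟨Module.finrank ℂ B, ?_⟩
    rintro n ⟨s, hs, rfl⟩
    exact hs.card_le hB
  obtain ⟨s, hs, hcard⟩ := Nat.sSup_mem hne hbdd
  have hmax : ∀ t : Finset A, AfAuxGood B t → t.card ≤ s.card := by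
    intro t ht
    rw [hcard]
    exact le_csSup hbdd ⟨t, ht, rfl⟩
  -- adding an orthogonal projection is impossible
  refine ⟨s, hs, ?_, ?_⟩
  · intro p hp e heB hes hee hpe he0
    by_contra hne
    obtain ⟨hpB, hps, hpp, hp0⟩ := hs.1 p hp
    have hep : e * p = e := by
      have := congrArg star hpe
      simpa [hps.star_eq, hes.star_eq] using this
    have hqe : ∀ q ∈ s.erase p, q * e = 0 ∧ e * q = 0 ∧ q * p = 0 ∧ p * q = 0 := by
      intro q hq
      obtain ⟨hqp, hq⟩ := Finset.mem_erase.1 hq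
      have h1 := hs.2 q hq p hp hqp
      have h2 := hs.2 p hp q hq hqp.symm
      refine ⟨?_, ?_, h1, h2⟩
      · rw [← hpe, ← mul_assoc, h1, zero_mul]
      · rw [← hep, mul_assoc, h2, mul_zero]
    have hf0 : p - e ≠ 0 := fun h => hne (sub_eq_zero.1 h).symm
    have hff : (p - e) * (p - e) = p - e := by
      rw [mul_sub, sub_mul, sub_mul, hpp, hep, hpe, hee]; simp
    have hef : e * (p - e) = 0 := by rw [mul_sub, hep, hee, sub_self]
    have hfe : (p - e) * e = 0 := by rw [sub_mul, hpe, hee, sub_self]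
    have hn1 : p - e ∉ s.erase p := by
      intro h
      have := (hqe _ h).2.2.1
      rw [sub_mul, hpp, hep] at this
      exact hf0 this
    have hn2 : e ∉ insert (p - e) (s.erase p) := by
      intro h
      rcases Finset.mem_insert.1 h with h | h
      · rw [← h, hee] at hef; exact he0 hef
      · have := (hqe _ h).1
        rw [hee] at this; exact he0 this
    have hgood : AfAuxGood B (insert e (insert (p - e) (s.erase p))) := by
      constructor
      · intro q hq
        simp only [Finset.mem_insert] at hq
        rcases hq with rfl | rfl | hq
        · exact ⟨heB, hes, hee, he0⟩
        · exact ⟨sub_mem hpB heB, hps.sub hes, hff, hf0⟩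
        · exact hs.1 q (Finset.mem_of_mem_erase hq)
      · intro q hq q' hq' hqq'
        simp only [Finset.mem_insert] at hq hq'
        rcases hq with rfl | rfl | hq <;> rcases hq' with rfl | rfl | hq'
        · exact absurd rfl hqq'
        · exact hef
        · exact (hqe _ hq').2.1
        · exact hfe
        · exact absurd rfl hqq'
        · rw [sub_mul, (hqe _ hq').2.1, (hqe _ hq').2.2.2, sub_self]
        · exact (hqe _ hq).1
        · rw [mul_sub, (hqe _ hq).1, (hqe _ hq).2.2.1, sub_self]
        · exact hs.2 q (Finset.mem_of_mem_erase hq) q' (Finset.mem_of_mem_erase hq') hqq'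
    have := hmax _ hgood
    rw [Finset.card_insert_of_notMem hn2, Finset.card_insert_of_notMem hn1,
      Finset.card_erase_of_mem hp] at this
    have := Finset.card_pos.2 ⟨p, hp⟩
    omega
  · intro b hb
    set P := ∑ p ∈ s, p with hP
    have hPB : P ∈ B := sum_mem fun p hp => (hs.1 p hp).1
    have hPp : ∀ p ∈ s, P * p = p := by
      intro p hp
      rw [hP, Finset.sum_mul, Finset.sum_eq_single p]
      · exact (hs.1 p hp).2.2.1
      · intro q hq hqp; exact hs.2 q hq p hp hqp
      · exact fun h => absurd hp h
    by_contra hne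
    set y := b - b * P with hy
    have hyB : y ∈ B := sub_mem hb (mul_mem hb hPB)
    have hy0 : y ≠ 0 := fun h => hne (sub_eq_zero.1 h).symm
    have hyp : ∀ p ∈ s, y * p = 0 := by
      intro p hp
      rw [hy, sub_mul, mul_assoc, hPp p hp, sub_self]
    have hyy : star y * y ≠ 0 := by
      intro h; exact hy0 (CStarRing.star_mul_self_eq_zero_iff y |>.1 h)
    obtain ⟨e, c, heB, hes, hee, he0, hc, hxe, hex⟩ := afAux_eigen B hB (star y * y) 
      (mul_mem (star_mem hyB) hyB) (IsSelfAdjoint.star_mul_self y) hyy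
    have hep : ∀ p ∈ s, e * p = 0 := by
      intro p hp
      have h4 : (c:ℂ) • (e * p) = 0 := by
        rw [← smul_mul_assoc, ← hex, mul_assoc, mul_assoc, hyp p hp, mul_zero, mul_zero]
      exact (smul_eq_zero.1 h4).resolve_left (by exact_mod_cast hc)
    have hpe : ∀ p ∈ s, p * e = 0 := by
      intro p hp
      have := congrArg star (hep p hp)
      simpa [(hs.1 p hp).2.1.star_eq, hes.star_eq] using this
    have hes' : e ∉ s := fun h => he0 (by rw [← hee, hep e h])
    have hgood : AfAuxGood B (insert e s) := by
      constructor
      · intro q hq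
        rcases Finset.mem_insert.1 hq with rfl | hq
        · exact ⟨heB, hes, hee, he0⟩
        · exact hs.1 q hq
      · intro q hq q' hq' hqq'
        rw [Finset.mem_insert] at hq hq'
        rcases hq with rfl | hq <;> rcases hq' with rfl | hq'
        · exact absurd rfl hqq'
        · exact hep _ hq'
        · exact hpe _ hq
        · exact hs.2 _ hq _ hq' hqq'
    have := hmax _ hgood
    rw [Finset.card_insert_of_notMem hes'] at this
    omega

lemma afAux_structure (B : NonUnitalStarSubalgebra ℂ A) (hB : FiniteDimensional ℂ B) :
    ∃ (s : Finset A) (r v : A → A), 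
      (∀ p ∈ s, IsSelfAdjoint p ∧ p * p = p) ∧
      (∀ p ∈ s, ∀ q ∈ s, p ≠ q → p * q = 0) ∧
      (∀ p ∈ s, p ∈ B ∧ r p ∈ s ∧ v p ∈ B ∧ star (v p) * v p = r p ∧ v p * star (v p) = p) ∧
      (∀ b ∈ B, b ∈ Submodule.span ℂ
        {y : A | ∃ p ∈ s, ∃ q ∈ s, r p = r q ∧ y = v p * star (v q)}) := by
  obtain ⟨s, hs, hmin, hunit⟩ := afAux_max B hB
  let R : A → A → Prop := fun p q => ∃ v ∈ B, star v * v = q ∧ v * star v = p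
  have habs : ∀ (v p q : A), p * p = p → q * q = q → star v * v = q → v * star v = p → 
      v * q = v ∧ p * v = v := by
    intro v p q hpp hqq h1 h2
    have key : v * q = v := by
      have hqs : star q = q := by rw [← h1]; simp
      have : star (v - v * q) * (v - v * q) = 0 := by
        simp only [star_sub, star_mul, sub_mul, mul_sub, hqs]
        have e1 : q * star v * v = q := by rw [mul_assoc, h1, hqq]
        have e2 : star v * (v * q) = q := by rw [← mul_assoc, h1, hqq]
        have e3 : q * star v * (v * q) = q := by rw [← mul_assoc, e1, hqq]
        rw [e1, e2, e3, h1]; simp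
      exact (sub_eq_zero.1 (CStarRing.star_mul_self_eq_zero_iff _ |>.1 this)).symm
    refine ⟨key, ?_⟩
    rw [← h2, mul_assoc, h1, key]
  have hRrefl : ∀ p ∈ s, R p p := by
    intro p hp
    obtain ⟨h1, h2, h3, _⟩ := hs.1 p hp
    exact ⟨p, h1, by rw [h2.star_eq, h3], by rw [h2.star_eq, h3]⟩
  have hRsymm : ∀ p q, R p q → R q p := by
    rintro p q ⟨v, hv, h1, h2⟩
    exact ⟨star v, star_mem hv, by simpa using h2, by simpa using h1⟩
  have hRtrans : ∀ p ∈ s, ∀ q ∈ s, ∀ t ∈ s, R p q → R q t → R p t := by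
    rintro p hp q hq t ht ⟨v, hv, h1, h2⟩ ⟨w, hw, h3, h4⟩
    refine ⟨v * w, mul_mem hv hw, ?_, ?_⟩
    · rw [star_mul, mul_assoc, ← mul_assoc (star v), h1, 
        (habs w q t (hs.1 q hq).2.2.1 (hs.1 t ht).2.2.1 h3 h4).2, h3]
    · rw [star_mul, mul_assoc, ← mul_assoc w, h4, ← mul_assoc, 
        (habs v p q (hs.1 p hp).2.2.1 (hs.1 q hq).2.2.1 h1 h2).1, h2]
  have _ : Nonempty A := ⟨0⟩
  let r : A → A := fun p => Classical.epsilon (fun q => q ∈ s ∧ R p q)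
  have hr : ∀ p ∈ s, r p ∈ s ∧ R p (r p) := fun p hp =>
    Classical.epsilon_spec (p := fun q => q ∈ s ∧ R p q) ⟨p, hp, hRrefl p hp⟩
  have hreq : ∀ p ∈ s, ∀ q ∈ s, R p q → r p = r q := by
    intro p hp q hq hpq
    have : (fun t => t ∈ s ∧ R p t) = (fun t => t ∈ s ∧ R q t) := by
      funext t
      apply propext
      constructor
      · rintro ⟨ht, h⟩; exact ⟨ht, hRtrans q hq p hp t ht (hRsymm _ _ hpq) h⟩
      · rintro ⟨ht, h⟩; exact ⟨ht, hRtrans p hp q hq t ht hpq h⟩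
    simp only [r, this]
  have hv' : ∀ p : A, ∃ v : A, p ∈ s → v ∈ B ∧ star v * v = r p ∧ v * star v = p := by
    intro p
    by_cases hp : p ∈ s
    · obtain ⟨v, h⟩ := (hr p hp).2
      exact ⟨v, fun _ => h⟩
    · exact ⟨0, fun h => absurd h hp⟩
  choose v hv using hv'
  refine ⟨s, r, v, fun p hp => ⟨(hs.1 p hp).2.1, (hs.1 p hp).2.2.1⟩, hs.2, 
    fun p hp => ⟨(hs.1 p hp).1, (hr p hp).1, hv p hp⟩, ?_⟩
  intro b hb
  have hPs : star (∑ p ∈ s, p) = ∑ p ∈ s, p := by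
    rw [star_sum]; exact Finset.sum_congr rfl fun p hp => (hs.1 p hp).2.1
  have hb1 := hunit b hb
  have hb2 : (∑ p ∈ s, p) * b = b := by
    have := congrArg star (hunit (star b) (star_mem hb))
    simpa only [star_mul, star_star, hPs] using this
  have hbsum : b = ∑ p ∈ s, ∑ q ∈ s, p * b * q := by
    conv_lhs => rw [← hb2, ← hb1, ← mul_assoc, Finset.sum_mul, Finset.sum_mul]
    exact Finset.sum_congr rfl fun p _ => Finset.mul_sum _ _ _
  rw [hbsum]
  refine Submodule.sum_mem _ fun p hp => Submodule.sum_mem _ fun q hq => ?_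
  by_cases h0 : p * b * q = 0
  · rw [h0]; exact Submodule.zero_mem _
  obtain ⟨hpB, hps, hpp, -⟩ := hs.1 p hp
  obtain ⟨hqB, hqs, hqq, -⟩ := hs.1 q hq
  have hRpq : R p q := afAux_equiv B hB q p hqB hpB hqs hqq (hmin q hq) hps hpp (hmin p hp) b hb h0
  have hrr := hreq p hp q hq hRpq
  obtain ⟨hrs, -⟩ := hr q hq
  obtain ⟨hrB, hrsa, hrid, -⟩ := hs.1 _ hrs
  obtain ⟨hvp, hp1, hp2⟩ := hv p hp
  obtain ⟨hvq, hq1, hq2⟩ := hv q hq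
  rw [hrr] at hp1
  have hap := (habs _ _ _ hpp hrid hp1 hp2).1
  have haq := (habs _ _ _ hqq hrid hq1 hq2).1
  have hap' : r q * star (v p) = star (v p) := by
    have := congrArg star hap
    rwa [star_mul, hrsa.star_eq] at this
  obtain ⟨c, hc⟩ := afAux_scalar B hB (r q) hrsa hrid (hmin _ hrs) (star (v p) * b * v q) 
    (mul_mem (mul_mem (star_mem hvp) hb) hvq) (by
      rw [← mul_assoc, ← mul_assoc, hap', mul_assoc, haq])
  have : p * b * q = c • (v p * star (v q)) := by
    calc p * b * q = (v p * star (v p)) * b * (v q * star (v q)) := by rw [hp2, hq2]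
      _ = v p * (star (v p) * b * v q) * star (v q) := by noncomm_ring
      _ = _ := by rw [hc, mul_smul_comm, smul_mul_assoc, hap]
  rw [this]
  exact Submodule.smul_mem _ _ (Submodule.subset_span ⟨p, hp, q, hq, hrr, rfl⟩)
end
section
open Filter Topology
variable {A : Type*} [CStarAlgebra A]

lemma afAux_pi (v q : A) (hqq : q * q = q) (h1 : star v * v = q) : v * q = v := by
  have hqs : star q = q := by rw [← h1]; simp
  have : star (v - v * q) * (v - v * q) = 0 := by
    simp only [star_sub, star_mul, sub_mul, mul_sub, hqs]
    have e1 : q * star v * v = q := by rw [mul_assoc, h1, hqq]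
    have e2 : star v * (v * q) = q := by rw [← mul_assoc, h1, hqq]
    have e3 : q * star v * (v * q) = q := by rw [← mul_assoc, e1, hqq]
    rw [e1, e2, e3, h1]; simp
  exact (sub_eq_zero.1 (CStarRing.star_mul_self_eq_zero_iff _ |>.1 this)).symm

lemma afAux_pi' (v q : A) (hqq : q * q = q) (h1 : v * star v = q) : q * v = v := by
  have hqs : star q = q := by rw [← h1]; simp
  have := congrArg star (afAux_pi (star v) q hqq (by simpa using h1))
  simpa [hqs] using this

lemma afAux_proj_eq (k e : A) (hk : IsSelfAdjoint k) (hkk : k * k = k) (he : IsSelfAdjoint e)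
    (hee : e * e = e) (hek : e * k = k) (hn : ‖e - k‖ < 1) : k = e := by
  have hke : k * e = k := by
    have := congrArg star hek
    simpa [hk.star_eq, he.star_eq] using this
  have hd : star (e - k) * (e - k) = e - k := by
    rw [(he.sub hk).star_eq, mul_sub, sub_mul, sub_mul, hee, hke, hek, hkk]; simp
  have h1 := CStarRing.norm_star_mul_self (x := e - k)
  rw [hd] at h1
  have h2 : ‖e - k‖ = 0 := by
    have := norm_nonneg (e - k)
    by_contra h0
    have h3 : 0 < ‖e - k‖ := lt_of_le_of_ne this (Ne.symm h0)
    nlinarith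
  exact (sub_eq_zero.1 (norm_eq_zero.1 h2)).symm

/-- perturbation of partial isometries -/
lemma afAux_polar (e f x : ℕ → A) (v : A) 
    (hes : ∀ n, IsSelfAdjoint (e n)) (hee : ∀ n, e n * e n = e n)
    (hfs : ∀ n, IsSelfAdjoint (f n)) (hff : ∀ n, f n * f n = f n)
    (hv : v * star v * v = v) (he : Tendsto e atTop (𝓝 (star v * v)))
    (hf : Tendsto f atTop (𝓝 (v * star v))) (hx : Tendsto x atTop (𝓝 v)) :
    ∃ w : ℕ → A, Tendsto w atTop (𝓝 v) ∧ ∀ᶠ n in atTop, star (w n) * w n = e n ∧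
      w n * star (w n) = f n ∧ ∀ S : NonUnitalStarSubalgebra ℂ A, IsClosed (S : Set A) → 
        x n ∈ S → e n ∈ S → f n ∈ S → w n ∈ S := by
  let y : ℕ → A := fun n => f n * x n * e n
  let h : ℕ → A := fun n => star (y n) * y n
  let d : ℕ → ℝ := fun n => ‖h n * h n - h n‖
  have hy : Tendsto y atTop (𝓝 v) := by
    have := (hf.mul hx).mul he
    rw [hv, ← mul_assoc, hv] at this
    exact this
  have hh : Tendsto h atTop (𝓝 (star v * v)) := hy.star.mul hy
  have hd : Tendsto d atTop (𝓝 0) := by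
    have := ((hh.mul hh).sub hh).norm
    rw [show star v * v * (star v * v) - star v * v = 0 by
      rw [mul_assoc, ← mul_assoc v, hv, sub_self], norm_zero] at this
    exact this
  have hsa : ∀ n, IsSelfAdjoint (h n) := fun n => IsSelfAdjoint.star_mul_self _
  have hex : ∀ n, ∃ g k : A, d n < 1/4 → (IsSelfAdjoint g ∧ IsSelfAdjoint k ∧ k * k = k ∧ 
      g * h n * g = k ∧ g * h n = h n * g ∧
      ‖g - k‖ ≤ 4 * d n ∧ ‖k - h n‖ ≤ 2 * d n ∧ 
      (∀ S : NonUnitalStarSubalgebra ℂ A, IsClosed (S : Set A) → h n ∈ S → g ∈ S ∧ k ∈ S)) := by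
    intro n
    by_cases hn : d n < 1/4
    · obtain ⟨g, k, H⟩ := afAux_cut (h n) (hsa n) hn
      exact ⟨g, k, fun _ => H⟩
    · exact ⟨0, 0, fun h => absurd h hn⟩
  choose g k hgk using hex
  have hd4 : ∀ᶠ n in atTop, d n < 1/4 := hd.eventually (gt_mem_nhds (by norm_num))
  have hye : ∀ n, y n * e n = y n := fun n => by simp only [y, mul_assoc, hee]
  have hfy : ∀ n, f n * y n = y n := fun n => by simp only [y, ← mul_assoc, hff]
  have hhe : ∀ n, h n * e n = h n := fun n => by simp only [h, mul_assoc, hye]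
  have hke : ∀ᶠ n in atTop, k n = e n := by
    have h1 : Tendsto (fun n => 2 * d n + ‖h n - e n‖) atTop (𝓝 0) := by
      have := (hd.const_mul 2).add (hh.sub he).norm
      simpa using this
    filter_upwards [hd4, h1.eventually (gt_mem_nhds zero_lt_one)] with n hn hn1
    obtain ⟨g1, k1, kk, ghg, gh, -, kh, -⟩ := hgk n hn
    have h2 : k n * e n = k n := by
      have h3 : k n = g n * (g n * h n) := by rw [← ghg, mul_assoc, ← gh]
      rw [h3, mul_assoc, mul_assoc, hhe]
    refine afAux_proj_eq _ _ k1 kk (hes n) (hee n) ?_ ?_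
    · have := congrArg star h2
      simpa [k1.star_eq, (hes n).star_eq] using this
    · rw [norm_sub_rev]
      calc ‖k n - e n‖ = ‖(k n - h n) + (h n - e n)‖ := by congr 1; abel
        _ ≤ ‖k n - h n‖ + ‖h n - e n‖ := norm_add_le _ _
        _ < 1 := by linarith
  let w : ℕ → A := fun n => y n * g n
  have hw : Tendsto w atTop (𝓝 v) := by
    have h1 : Tendsto (fun n => w n - y n) atTop (𝓝 0) := by
      have h2 : Tendsto (fun n => ‖y n‖ * (4 * d n)) atTop (𝓝 0) := by
        simpa using hy.norm.mul (hd.const_mul 4)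
      refine squeeze_zero_norm' ?_ h2
      filter_upwards [hd4, hke] with n hn hn1
      obtain ⟨-, -, -, -, -, hg, -, -⟩ := hgk n hn
      have : w n - y n = y n * (g n - k n) := by
        rw [mul_sub, hn1, hye]
      rw [this]
      exact (norm_mul_le _ _).trans (mul_le_mul_of_nonneg_left hg (norm_nonneg _))
    simpa using h1.add hy
  refine ⟨w, hw, ?_⟩
  have h1 : Tendsto (fun n => ‖f n - w n * star (w n)‖) atTop (𝓝 0) := by
    have := (hf.sub (hw.mul hw.star)).norm
    simpa using this
  filter_upwards [hd4, hke, h1.eventually (gt_mem_nhds zero_lt_one)] with n hn hn1 hn2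
  obtain ⟨g1, k1, kk, ghg, gh, -, kh, hS⟩ := hgk n hn
  have hww : star (w n) * w n = e n := by
    rw [← hn1, ← ghg]
    simp only [w, h, star_mul, g1.star_eq, mul_assoc]
  have hwe := afAux_pi _ _ (hee n) hww
  refine ⟨hww, ?_, ?_⟩
  · refine afAux_proj_eq _ _ (IsSelfAdjoint.mul_star_self _) ?_ (hfs n) (hff n) ?_ hn2
    · rw [mul_assoc, ← mul_assoc (star (w n)), hww, ← mul_assoc, hwe]
    · simp only [w, ← mul_assoc, hfy]
  · intro S hSc hxS heS hfS
    have hyS : y n ∈ S := mul_mem (mul_mem hfS hxS) heS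
    exact mul_mem hyS (hS S hSc (mul_mem (star_mem hyS) hyS)).1

lemma afAux_approx (As : ℕ → NonUnitalStarSubalgebra ℂ A) (hmono : Monotone As) (b : A)
    (hb : b ∈ closure (⋃ n, (As n : Set A))) :
    ∃ x : ℕ → A, (∀ n, x n ∈ As n) ∧ Tendsto x atTop (𝓝 b) := by
  have hne : ∀ n, (As n : Set A).Nonempty := fun n => ⟨0, zero_mem (As n)⟩
  have hex : ∀ n : ℕ, ∃ x ∈ As n, dist b x < Metric.infDist b (As n) + 1 / ((n:ℝ)+1) := by
    intro n
    have := (Metric.infDist_lt_iff (x := b) (hne n)).1 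
      (lt_add_of_pos_right (Metric.infDist b (As n)) (Nat.one_div_pos_of_nat (α := ℝ) (n := n)))
    exact this
  choose x hx hdist using hex
  refine ⟨x, hx, ?_⟩
  have h1 : Tendsto (fun n => Metric.infDist b (As n)) atTop (𝓝 0) := by
    rw [Metric.tendsto_atTop]
    intro ε hε
    obtain ⟨a, ha, hd⟩ := Metric.mem_closure_iff.1 hb ε hε
    obtain ⟨m, hm⟩ := Set.mem_iUnion.1 ha
    refine ⟨m, fun n hn => ?_⟩
    rw [Real.dist_eq, sub_zero, abs_of_nonneg Metric.infDist_nonneg]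
    exact (Metric.infDist_le_dist_of_mem (hmono hn hm)).trans_lt hd
  have h2 : Tendsto (fun n : ℕ => Metric.infDist b (As n) + 1 / ((n:ℝ)+1)) atTop (𝓝 0) := by
    simpa using h1.add tendsto_one_div_add_atTop_nhds_zero_nat
  rw [tendsto_iff_dist_tendsto_zero]
  refine squeeze_zero (fun _ => dist_nonneg) (fun n => ?_) h2
  rw [dist_comm]
  exact (hdist n).le

lemma afAux_projs (As : ℕ → NonUnitalStarSubalgebra ℂ A) (hcl : ∀ n, IsClosed (As n : Set A))
    (s : Finset A) (hs1 : ∀ p ∈ s, IsSelfAdjoint p ∧ p * p = p)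
    (hs2 : ∀ p ∈ s, ∀ q ∈ s, p ≠ q → p * q = 0)
    (happ : ∀ p ∈ s, ∃ x : ℕ → A, (∀ n, x n ∈ As n) ∧ Tendsto x atTop (𝓝 p)) :
    ∃ q : A → ℕ → A, (∀ p ∈ s, ∀ n, q p n ∈ As n ∧ IsSelfAdjoint (q p n) ∧ q p n * q p n = q p n) ∧
      (∀ p ∈ s, ∀ p' ∈ s, p ≠ p' → ∀ n, q p n * q p' n = 0) ∧
      (∀ p ∈ s, Tendsto (q p) atTop (𝓝 p)) := by
  classical
  induction s using Finset.induction_on with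
  | empty => exact ⟨fun _ _ => 0, by simp, by simp, by simp⟩
  | insert a s has ih =>
    obtain ⟨q, hq1, hq2, hq3⟩ := ih (fun p hp => hs1 p (Finset.mem_insert_of_mem hp))
      (fun p hp p' hp' => hs2 p (Finset.mem_insert_of_mem hp) p' (Finset.mem_insert_of_mem hp'))
      (fun p hp => happ p (Finset.mem_insert_of_mem hp))
    obtain ⟨x, hxA, hx⟩ := happ a (Finset.mem_insert_self a s)
    obtain ⟨has, haa⟩ := hs1 a (Finset.mem_insert_self a s)
    have hap : ∀ p ∈ s, p * a = 0 ∧ a * p = 0 := by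
      intro p hp
      have hne : p ≠ a := by rintro rfl; contradiction
      exact ⟨hs2 p (Finset.mem_insert_of_mem hp) a (Finset.mem_insert_self a s) hne,
        hs2 a (Finset.mem_insert_self a s) p (Finset.mem_insert_of_mem hp) hne.symm⟩
    let Q : ℕ → A := fun n => ∑ p ∈ s, q p n
    have hQA : ∀ n, Q n ∈ As n := fun n => sum_mem fun p hp => (hq1 p hp n).1
    have hQs : ∀ n, star (Q n) = Q n := by
      intro n
      simp only [Q, star_sum]
      exact Finset.sum_congr rfl fun p hp => (hq1 p hp n).2.1
    have hqQ : ∀ p ∈ s, ∀ n, q p n * Q n = q p n := by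
      intro p hp n
      simp only [Q, Finset.mul_sum]
      rw [Finset.sum_eq_single p]
      · exact (hq1 p hp n).2.2
      · intro p' hp' hne; exact hq2 p hp p' hp' hne.symm n
      · exact fun h => absurd hp h
    have hQ : Tendsto Q atTop (𝓝 (∑ p ∈ s, p)) := tendsto_finsetSum _ fun p hp => hq3 p hp
    let t : ℕ → A := fun n => x n + star (x n)
    have htA : ∀ n, t n ∈ As n := fun n => add_mem (hxA n) (star_mem (hxA n))
    have htsa : ∀ n, star (t n) = t n := fun n => by simp [t, add_comm]
    let y : ℕ → A := fun n => (1/2 : ℂ) • (t n - Q n * t n - t n * Q n + Q n * t n * Q n)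
    have hyA : ∀ n, y n ∈ As n := fun n => SMulMemClass.smul_mem _ (add_mem (sub_mem (sub_mem (htA n) 
      (mul_mem (hQA n) (htA n))) (mul_mem (htA n) (hQA n))) 
      (mul_mem (mul_mem (hQA n) (htA n)) (hQA n)))
    have hysa : ∀ n, IsSelfAdjoint (y n) := by
      intro n
      simp only [IsSelfAdjoint, y, star_smul, star_add, star_sub, star_mul, htsa, hQs, mul_assoc]
      congr 1
      · simp
      · abel
    have hqy : ∀ p ∈ s, ∀ n, q p n * y n = 0 := by
      intro p hp n
      simp only [y, mul_smul_comm, mul_add, mul_sub, ← mul_assoc, hqQ p hp n]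
      simp
    have hy : Tendsto y atTop (𝓝 a) := by
      have ht : Tendsto t atTop (𝓝 (a + star a)) := hx.add hx.star
      have h1 := (((ht.sub (hQ.mul ht)).sub (ht.mul hQ)).add ((hQ.mul ht).mul hQ)).const_smul (1/2:ℂ)
      have h2 : (∑ p ∈ s, p) * (a + star a) = 0 := by
        rw [has.star_eq, mul_add, Finset.sum_mul, Finset.sum_eq_zero fun p hp => (hap p hp).1, add_zero]
      have h3 : (a + star a) * (∑ p ∈ s, p) = 0 := by
        rw [has.star_eq, add_mul, Finset.mul_sum, Finset.sum_eq_zero fun p hp => (hap p hp).2, add_zero]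
      rw [h2, h3, has.star_eq] at h1
      convert h1 using 2
      simp only [zero_mul, sub_zero, add_zero]
      module
    let d : ℕ → ℝ := fun n => ‖y n * y n - y n‖
    have hd : Tendsto d atTop (𝓝 0) := by
      have := ((hy.mul hy).sub hy).norm
      simpa [haa] using this
    have hex : ∀ n, ∃ k : A, k ∈ As n ∧ IsSelfAdjoint k ∧ k * k = k ∧ 
        (∀ p ∈ s, q p n * k = 0) ∧ (d n < 1/4 → ‖k - y n‖ ≤ 2 * d n) := by
      intro n
      by_cases hn : d n < 1/4
      · obtain ⟨g, k, g1, k1, kk, ghg, gh, -, kh, hS⟩ := afAux_cut (y n) (hysa n) hn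
        refine ⟨k, (hS _ (hcl n) (hyA n)).2, k1, kk, ?_, fun _ => kh⟩
        intro p hp
        rw [← ghg, gh, ← mul_assoc, ← mul_assoc, hqy p hp n, zero_mul, zero_mul]
      · exact ⟨0, zero_mem _, by simp, by simp, by simp, fun h => absurd h hn⟩
    choose k hkA hks hkk hqk hk using hex
    have hka : Tendsto k atTop (𝓝 a) := by
      have h1 : Tendsto (fun n => k n - y n) atTop (𝓝 0) := by
        refine squeeze_zero_norm' ?_ (show Tendsto (fun n => 2 * d n) atTop (𝓝 0) by
          simpa using hd.const_mul 2)
        filter_upwards [hd.eventually (gt_mem_nhds (show (0:ℝ) < 1/4 by norm_num))] with n hn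
        exact hk n hn
      simpa using h1.add hy
    have hkq : ∀ p ∈ s, ∀ n, k n * q p n = 0 := by
      intro p hp n
      have := congrArg star (hqk n p hp)
      simpa [(hks n).star_eq, (hq1 p hp n).2.1.star_eq] using this
    refine ⟨fun p => if p = a then k else q p, ?_, ?_, ?_⟩
    · intro p hp n
      by_cases h : p = a
      · simp only [h, if_true]; exact ⟨hkA n, hks n, hkk n⟩
      · simp only [h, if_false]; exact hq1 p ((Finset.mem_insert.1 hp).resolve_left h) n
    · intro p hp p' hp' hne n
      by_cases h : p = a <;> by_cases h' : p' = a
      · exact absurd (h.trans h'.symm) hne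
      · simp only [h, h', if_true, if_false]
        exact hkq p' ((Finset.mem_insert.1 hp').resolve_left h') n
      · simp only [h, h', if_true, if_false]
        exact hqk n p ((Finset.mem_insert.1 hp).resolve_left h)
      · simp only [h, h', if_false]
        exact hq2 p ((Finset.mem_insert.1 hp).resolve_left h) p' 
          ((Finset.mem_insert.1 hp').resolve_left h') hne n
    · intro p hp
      by_cases h : p = a
      · simp only [h, if_true]; exact hka
      · simp only [h, if_false]; exact hq3 p ((Finset.mem_insert.1 hp).resolve_left h)
end
section
open Filter Topology
variable {A : Type*} [CStarAlgebra A]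

lemma afAux_isometry (s : Finset A) (t a b : A → A) (R : A)
    (hb : ∀ p ∈ s, b p * b p = b p) (hbs : ∀ p ∈ s, IsSelfAdjoint (b p))
    (horth : ∀ p ∈ s, ∀ q ∈ s, p ≠ q → b p * b q = 0)
    (h1 : ∀ p ∈ s, star (t p) * t p = a p) (h2 : ∀ p ∈ s, t p * star (t p) = b p)
    (hR1 : star R * R = 1 - ∑ p ∈ s, a p) (hR2 : R * star R = 1 - ∑ p ∈ s, b p) :
    star (∑ p ∈ s, t p + R) * (∑ p ∈ s, t p + R) = 1 := by
  have hbt : ∀ p ∈ s, b p * t p = t p := fun p hp => afAux_pi' _ _ (hb p hp) (h2 p hp)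
  have hSb : ∀ p ∈ s, (∑ q ∈ s, b q) * b p = b p := by
    intro p hp
    rw [Finset.sum_mul, Finset.sum_eq_single p]
    · exact hb p hp
    · intro q hq hne; exact horth q hq p hp hne
    · exact fun h => absurd hp h
  have hSS : (∑ q ∈ s, b q) * (∑ q ∈ s, b q) = ∑ q ∈ s, b q := by
    rw [Finset.mul_sum]; exact Finset.sum_congr rfl hSb
  have hR : (1 - ∑ p ∈ s, b p) * R = R := 
    afAux_pi' _ _ (by rw [mul_sub, sub_mul, sub_mul, hSS]; simp) hR2
  have htR : ∀ p ∈ s, star R * t p = 0 := by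
    intro p hp
    have hs : star (∑ q ∈ s, b q) = ∑ q ∈ s, b q := by
      rw [star_sum]; exact Finset.sum_congr rfl fun p hp => hbs p hp
    rw [← hR, star_mul, ← hbt p hp, star_sub, hs, star_one, mul_assoc, ← mul_assoc _ (b p),
      sub_mul, hSb p hp]
    simp
  have hRt : ∀ p ∈ s, star (t p) * R = 0 := by
    intro p hp
    have := congrArg star (htR p hp)
    simpa using this
  have htt : ∀ p ∈ s, ∀ q ∈ s, p ≠ q → star (t p) * t q = 0 := by
    intro p hp q hq hne
    rw [← hbt p hp, ← hbt q hq, star_mul, (hbs p hp).star_eq, mul_assoc, ← mul_assoc (b p),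
      horth p hp q hq hne]
    simp
  rw [star_add, add_mul, mul_add, mul_add, hR1, star_sum, Finset.sum_mul, Finset.sum_mul,
    Finset.mul_sum, Finset.sum_eq_zero hRt, Finset.sum_eq_zero htR]
  have : ∑ p ∈ s, star (t p) * ∑ q ∈ s, t q = ∑ p ∈ s, a p := by
    refine Finset.sum_congr rfl fun p hp => ?_
    rw [Finset.mul_sum, Finset.sum_eq_single p, h1 p hp]
    · intro q hq hne; exact htt p hp q hq hne.symm
    · exact fun h => absurd hp h
  rw [this]; simp

theorem afAux_main (As : ℕ → NonUnitalStarSubalgebra ℂ A) (hmono : Monotone As)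
    (hcl : ∀ n, IsClosed (As n : Set A))
    (B : NonUnitalStarSubalgebra ℂ A) (hB : FiniteDimensional ℂ B)
    (hBA : ∀ b ∈ B, b ∈ closure (⋃ n, (As n : Set A))) (ε : ℝ) (hε : 0 < ε) :
    ∃ (n : ℕ) (U : A), U ∈ unitary A ∧ ‖U - 1‖ < ε ∧ ∀ b ∈ B, U * b * star U ∈ As n := by
  obtain ⟨s, r, v, hs1, hs2, hs3, hspan⟩ := afAux_structure B hB
  have happ := fun b hb => afAux_approx As hmono b (hBA b hb)
  obtain ⟨q, hq1, hq2, hq3⟩ := afAux_projs As hcl s hs1 hs2 (fun p hp => happ p (hs3 p hp).1)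
  have hvr : ∀ p ∈ s, v p * r p = v p := fun p hp => 
    afAux_pi _ _ (hs1 _ (hs3 p hp).2.1).2 (hs3 p hp).2.2.2.1
  have hpv : ∀ p ∈ s, p * v p = v p := fun p hp => 
    afAux_pi' _ _ (hs1 _ hp).2 (hs3 p hp).2.2.2.2

  have hw' : ∀ p, ∃ w : ℕ → A, p ∈ s → Tendsto w atTop (𝓝 (v p)) ∧ 
      ∀ᶠ n in atTop, star (w n) * w n = q (r p) n ∧ w n * star (w n) = q p n ∧ w n ∈ As n := by
    intro p
    by_cases hp : p ∈ s
    · obtain ⟨hpB, hrs, hvB, hv1, hv2⟩ := hs3 p hp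
      obtain ⟨x, hxA, hx⟩ := happ (v p) hvB
      obtain ⟨w, hw, hw2⟩ := afAux_polar (q (r p)) (q p) x (v p) (fun n => (hq1 _ hrs n).2.1)
        (fun n => (hq1 _ hrs n).2.2) (fun n => (hq1 _ hp n).2.1) (fun n => (hq1 _ hp n).2.2)
        (by rw [hv2, hpv p hp]) (by rw [hv1]; exact hq3 _ hrs) (by rw [hv2]; exact hq3 _ hp) hx
      refine ⟨w, fun _ => ⟨hw, hw2.mono ?_⟩⟩
      rintro n ⟨h1, h2, h3⟩
      exact ⟨h1, h2, h3 _ (hcl n) (hxA n) (hq1 _ hrs n).1 (hq1 _ hp n).1⟩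
    · exact ⟨0, fun h => absurd h hp⟩
  choose w hw using hw'
  have hz' : ∀ p, ∃ z : ℕ → A, p ∈ s → Tendsto z atTop (𝓝 p) ∧ 
      ∀ᶠ n in atTop, star (z n) * z n = p ∧ z n * star (z n) = q p n := by
    intro p
    by_cases hp : p ∈ s
    · obtain ⟨hps, hpp⟩ := hs1 p hp
      obtain ⟨z, hz, hz2⟩ := afAux_polar (fun _ => p) (q p) (fun _ => p) p (fun n => hps)
        (fun n => hpp) (fun n => (hq1 _ hp n).2.1) (fun n => (hq1 _ hp n).2.2)
        (by rw [hps.star_eq, hpp, hpp]) (by rw [hps.star_eq, hpp]; exact tendsto_const_nhds) 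
        (by rw [hps.star_eq, hpp]; exact hq3 _ hp) tendsto_const_nhds
      exact ⟨z, fun _ => ⟨hz, hz2.mono fun n h => ⟨h.1, h.2.1⟩⟩⟩
    · exact ⟨0, fun h => absurd h hp⟩
  choose z hz using hz'
  have hcompl : ∀ (f : A → A), (∀ p ∈ s, IsSelfAdjoint (f p) ∧ f p * f p = f p) → 
      (∀ p ∈ s, ∀ p' ∈ s, p ≠ p' → f p * f p' = 0) → 
      (∀ p ∈ s, (1 - ∑ p ∈ s, f p) * f p = 0) ∧
      IsSelfAdjoint (1 - ∑ p ∈ s, f p) ∧ 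
      (1 - ∑ p ∈ s, f p) * (1 - ∑ p ∈ s, f p) = 1 - ∑ p ∈ s, f p := by
    intro f hf1 hf2
    have hk : ∀ p ∈ s, (∑ p ∈ s, f p) * f p = f p := by
      intro p hp
      rw [Finset.sum_mul, Finset.sum_eq_single p]
      · exact (hf1 p hp).2
      · intro q hq hne; exact hf2 q hq p hp hne
      · exact fun h => absurd hp h
    have hk' : (∑ p ∈ s, f p) * (∑ p ∈ s, f p) = ∑ p ∈ s, f p := by
      rw [Finset.mul_sum]; exact Finset.sum_congr rfl hk
    refine ⟨fun p hp => by rw [sub_mul, hk p hp]; simp, ?_, ?_⟩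
    · rw [IsSelfAdjoint, star_sub, star_one, star_sum]
      congr 1
      exact Finset.sum_congr rfl fun p hp => (hf1 p hp).1
    · rw [mul_sub, sub_mul, sub_mul, hk']; simp
  obtain ⟨hP0, hPs, hPP⟩ := hcompl (fun p => p) hs1 hs2
  have hQ := fun n => hcompl (fun p => q p n) (fun p hp => (hq1 p hp n).2) 
    (fun p hp p' hp' hne => hq2 p hp p' hp' hne n)
  have hQlim : Tendsto (fun n => 1 - ∑ p ∈ s, q p n) atTop (𝓝 (1 - ∑ p ∈ s, p)) :=
    tendsto_const_nhds.sub (tendsto_finsetSum _ fun p hp => hq3 p hp)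
  obtain ⟨R, hR, hR2⟩ := afAux_polar (fun _ => 1 - ∑ p ∈ s, p) (fun n => 1 - ∑ p ∈ s, q p n)
    (fun _ => 1 - ∑ p ∈ s, p) (1 - ∑ p ∈ s, p) (fun _ => hPs) (fun _ => hPP)
    (fun n => (hQ n).2.1) (fun n => (hQ n).2.2) (by rw [hPs.star_eq, hPP, hPP])
    (by rw [hPs.star_eq, hPP]; exact tendsto_const_nhds) (by rw [hPs.star_eq, hPP]; exact hQlim)
    tendsto_const_nhds
  let t : A → ℕ → A := fun p n => w p n * z (r p) n * star (v p)
  let U : ℕ → A := fun n => ∑ p ∈ s, t p n + R n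
  have hU : Tendsto U atTop (𝓝 1) := by
    have h1 : ∀ p ∈ s, Tendsto (t p) atTop (𝓝 p) := by
      intro p hp
      have := ((hw p hp).1.mul (hz (r p) (hs3 p hp).2.1).1).mul 
        (tendsto_const_nhds (x := star (v p)))
      rw [hvr p hp, (hs3 p hp).2.2.2.2] at this
      exact this
    have := (tendsto_finsetSum s h1).add hR
    simpa using this
  have hU1 : ∀ᶠ n in atTop, ‖U n - 1‖ < ε := by
    have : Tendsto (fun n => ‖U n - 1‖) atTop (𝓝 0) := by
      simpa using (hU.sub (tendsto_const_nhds (x := (1:A)))).norm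
    exact this.eventually (gt_mem_nhds hε)
  have hwe : ∀ᶠ n in atTop, ∀ p ∈ s, 
      star (w p n) * w p n = q (r p) n ∧ w p n * star (w p n) = q p n ∧ w p n ∈ As n :=
    (Finset.eventually_all s).2 fun p hp => (hw p hp).2
  have hze : ∀ᶠ n in atTop, ∀ p ∈ s, star (z p n) * z p n = p ∧ z p n * star (z p n) = q p n :=
    (Finset.eventually_all s).2 fun p hp => (hz p hp).2
  obtain ⟨n, hn1, hnw, hnz, hnR⟩ := (hU1.and (hwe.and (hze.and hR2))).exists
  have hwq : ∀ p ∈ s, w p n * q (r p) n = w p n := fun p hp => 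
    afAux_pi _ _ (hq1 _ (hs3 p hp).2.1 n).2.2 (hnw p hp).1
  have hqz : ∀ p ∈ s, q p n * z p n = z p n := fun p hp => 
    afAux_pi' _ _ (hq1 _ hp n).2.2 (hnz p hp).2
  have hzp : ∀ p ∈ s, z p n * p = z p n := fun p hp => 
    afAux_pi _ _ (hs1 p hp).2 (hnz p hp).1
  have ht1 : ∀ p ∈ s, star (t p n) * t p n = p := by
    intro p hp
    obtain ⟨hpB, hrs, hvB, hv1, hv2⟩ := hs3 p hp
    calc star (t p n) * t p n = v p * (star (z (r p) n) * ((star (w p n) * w p n) * z (r p) n)) 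
          * star (v p) := by simp only [t, star_mul, star_star, mul_assoc]
      _ = p := by rw [(hnw p hp).1, hqz _ hrs, (hnz _ hrs).1, hvr p hp, hv2]
  have ht2 : ∀ p ∈ s, t p n * star (t p n) = q p n := by
    intro p hp
    obtain ⟨hpB, hrs, hvB, hv1, hv2⟩ := hs3 p hp
    calc t p n * star (t p n) = w p n * ((z (r p) n * (star (v p) * v p)) * star (z (r p) n)) 
          * star (w p n) := by simp only [t, star_mul, star_star, mul_assoc]
      _ = q p n := by rw [hv1, hzp _ hrs, (hnz _ hrs).2, hwq p hp, (hnw p hp).2.1]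
  have hu1 : star (U n) * U n = 1 := 
    afAux_isometry s (fun p => t p n) (fun p => p) (fun p => q p n) (R n) 
      (fun p hp => (hq1 p hp n).2.2) (fun p hp => (hq1 p hp n).2.1)
      (fun p hp p' hp' hne => hq2 p hp p' hp' hne n) ht1 ht2 hnR.1 hnR.2.1
  have hu2 : U n * star (U n) = 1 := by
    have := afAux_isometry s (fun p => star (t p n)) (fun p => q p n) (fun p => p) (star (R n)) 
      (fun p hp => (hs1 p hp).2) (fun p hp => (hs1 p hp).1) hs2 
      (fun p hp => by simpa using ht2 p hp) (fun p hp => by simpa using ht1 p hp)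
      (by simpa using hnR.2.1) (by simpa using hnR.1)
    simpa [U, star_sum] using this
  refine ⟨n, U n, Unitary.mem_iff.2 ⟨hu1, hu2⟩, hn1, ?_⟩
  have hRP : R n * (1 - ∑ p ∈ s, p) = R n := afAux_pi _ _ hPP hnR.1
  have hUv : ∀ p ∈ s, U n * v p = w p n * z (r p) n := by
    intro p hp
    obtain ⟨hpB, hrs, hvB, hv1, hv2⟩ := hs3 p hp
    have h1 : R n * v p = 0 := by
      rw [← hRP, ← hpv p hp, mul_assoc, ← mul_assoc _ p, hP0 p hp]; simp
    simp only [U]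
    rw [add_mul, h1, add_zero, Finset.sum_mul, Finset.sum_eq_single p]
    · simp only [t]
      rw [mul_assoc, hv1, mul_assoc, hzp _ hrs]
    · intro p' hp' hne
      simp only [t]
      have h2 : star (v p') * v p = 0 := by
        rw [← hpv p hp, ← hpv p' hp', star_mul, (hs1 p' hp').1.star_eq, mul_assoc, 
          ← mul_assoc p', hs2 p' hp' p hp hne]
        simp
      rw [mul_assoc, h2, mul_zero]
    · exact fun h => absurd hp h
  intro b hb
  refine Submodule.span_induction (p := fun b _ => U n * b * star (U n) ∈ As n) ?_ ?_ ?_ ?_ 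
    (hspan b hb)
  · rintro y ⟨p, hp, p', hp', hrr, rfl⟩
    have : U n * (v p * star (v p')) * star (U n) = w p n * star (w p' n) := by
      calc U n * (v p * star (v p')) * star (U n) = (U n * v p) * star (U n * v p') := by
            rw [star_mul]; simp only [mul_assoc]
        _ = w p n * (z (r p) n * star (z (r p) n)) * star (w p' n) := by
            rw [hUv p hp, hUv p' hp', ← hrr, star_mul]; simp only [mul_assoc]
        _ = _ := by rw [(hnz _ (hs3 p hp).2.1).2, hwq p hp]
    rw [this]
    exact mul_mem (hnw p hp).2.2 (star_mem (hnw p' hp').2.2)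
  · simp
  · intro x y _ _ hx hy
    rw [mul_add, add_mul]; exact add_mem hx hy
  · intro c x _ hx
    rw [mul_smul_comm, smul_mul_assoc]; exact SMulMemClass.smul_mem _ hx
end
variable {A : Type*} [NonUnitalCStarAlgebra A]

theorem exists_unitary_conjugating_finiteDimensional_into_chain
    (As : ℕ → NonUnitalStarSubalgebra ℂ A)
    (hmono : Monotone As)
    (hfd : ∀ n, FiniteDimensional ℂ (As n))
    (hdense : Dense (⋃ n, (As n : Set A)))
    (B : NonUnitalStarSubalgebra ℂ A) (hB : FiniteDimensional ℂ B)
    (ε : ℝ) (hε : 0 < ε) :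
    ∃ (n : ℕ) (U : Unitization ℂ A),
      U ∈ unitary (Unitization ℂ A) ∧ ‖U - 1‖ < ε ∧
      ∀ b ∈ B, ∃ a ∈ As n,
        (↑a : Unitization ℂ A) = U * (↑b : Unitization ℂ A) * star U := by
  let φ := Unitization.inrNonUnitalStarAlgHom ℂ A
  have hfin : ∀ S : NonUnitalStarSubalgebra ℂ A, FiniteDimensional ℂ S → 
      FiniteDimensional ℂ (S.map φ) := by
    intro S hS
    have : FiniteDimensional ℂ S.toSubmodule := hS
    have h2 : FiniteDimensional ℂ (S.toSubmodule.map (φ : A →ₗ[ℂ] Unitization ℂ A)) := inferInstance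
    exact h2
  have hcont : Continuous (φ : A → Unitization ℂ A) := Unitization.continuous_inr
  obtain ⟨n, U, hU, hU1, hUB⟩ := afAux_main (fun n => (As n).map φ)
    (fun m n h => NonUnitalStarSubalgebra.map_mono (hmono h))
    (fun n => by
      have := hfin _ (hfd n)
      exact ((As n).map φ).toSubmodule.closed_of_finiteDimensional)
    (B.map φ) (hfin B hB) (by
      rintro _ ⟨b, hb, rfl⟩
      have h1 : φ b ∈ closure (φ '' (⋃ n, (As n : Set A))) := 
        image_closure_subset_closure_image hcont ⟨b, hdense b, rfl⟩
      rw [Set.image_iUnion] at h1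
      exact h1) ε hε
  refine ⟨n, U, hU, hU1, fun b hb => ?_⟩
  obtain ⟨a, ha, h⟩ := hUB (φ b) ⟨b, hb, rfl⟩
  exact ⟨a, ha, h⟩
end
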